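/- If p = p(n) satisfies p ≥ 1/(2√n), then w.h.p. the geometric realization of the random 2-complex Y(n,p) is simply connected (path-connected with trivial fundamental group). -/

import Mathlib

open MeasureTheory Filter Finset Matrix

noncomputable section

/-- Bernoulli measure on `Bool` with success probability `p` (clamped to `[0,1]`). -/
def bernoulliBool (p : ℝ) : Measure Bool :=
  ENNReal.ofReal (max 0 (min p 1)) • Measure.dirac true +
    ENNReal.ofReal (1 - max 0 (min p 1)) • Measure.dirac false

instance (p : ℝ) : IsFiniteMeasure (bernoulliBool p) := by
  constructor
  simp only [bernoulliBool, Measure.add_apply, Measure.smul_apply, smul_eq_mul,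
    measure_univ, mul_one]
  exact ENNReal.add_lt_top.mpr ⟨ENNReal.ofReal_lt_top, ENNReal.ofReal_lt_top⟩

/-- Index type for potential `d`-dimensional faces on vertex set `Fin n`:
the `(d+1)`-element subsets. -/
abbrev FaceIdx (n d : ℕ) : Type := {s : Finset (Fin n) // s.card = d + 1}

/-- The distribution of the random `d`-complex `Y_d(n,p)`: each potential `d`-face
gets an independent Bernoulli(`p`) coin. (For `d = 1` this is the Erdős–Rényi model
`G(n,p)`.) -/
def YMeasure (n d : ℕ) (p : ℝ) : Measure (FaceIdx n d → Bool) :=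
  Measure.pi fun _ => bernoulliBool p

/-- The random `d`-complex: all faces of dimension `≤ d - 1` (i.e. all subsets of
cardinality `≤ d`, including `∅`, so that degree-0 homology below is reduced
homology), together with the chosen `d`-faces. -/
def Ycomplex (n d : ℕ) (ω : FaceIdx n d → Bool) : Finset (Finset (Fin n)) :=
  Finset.univ.filter fun s => s.card ≤ d ∨ ∃ h : s.card = d + 1, ω ⟨s, h⟩ = true

/-- The Erdős–Rényi random graph associated to a configuration of edge coins. -/
def graphOf (n : ℕ) (ω : FaceIdx n 1 → Bool) : SimpleGraph (Fin n) where
  Adj i j := i ≠ j ∧ ∃ e : FaceIdx n 1, ω e = true ∧ i ∈ e.1 ∧ j ∈ e.1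
  symm := ⟨fun i j ⟨hne, e, he, hi, hj⟩ => ⟨hne.symm, e, he, hj, hi⟩⟩
  loopless := ⟨fun i ⟨hne, _⟩ => hne rfl⟩

instance (n : ℕ) (ω : FaceIdx n 1 → Bool) : DecidableRel (graphOf n ω).Adj :=
  fun i j =>
    inferInstanceAs (Decidable (i ≠ j ∧ ∃ e : FaceIdx n 1, ω e = true ∧ i ∈ e.1 ∧ j ∈ e.1))

/-- The clique complex of the graph determined by the edge coins `ω`:
faces are vertex sets of complete subgraphs (including `∅` and singletons). -/
def cliqueComplex (n : ℕ) (ω : FaceIdx n 1 → Bool) : Finset (Finset (Fin n)) :=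
  Finset.univ.filter fun s => ∀ i ∈ s, ∀ j ∈ s, i ≠ j → (graphOf n ω).Adj i j

/-- The group of simplicial `G`-chains of a complex `K`, in cardinality `c`
(i.e. dimension `c - 1`): functions on the faces of `K` of cardinality `c`. -/
abbrev Chains {V : Type} [Fintype V] [DecidableEq V]
    (K : Finset (Finset V)) (c : ℕ) (G : Type) : Type :=
  {s : Finset V // s ∈ K ∧ s.card = c} → G

/-- The simplicial boundary map, from chains of cardinality `c+1` to chains of
cardinality `c`, with the usual alternating signs coming from the linear order
on the vertices. -/
def chainBoundary {V : Type} [Fintype V] [DecidableEq V] [LinearOrder V]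
    (K : Finset (Finset V)) (c : ℕ) {G : Type} [AddCommGroup G]
    (f : Chains K (c + 1) G) : Chains K c G :=
  fun τ => ∑ v : V,
    if h : v ∉ τ.1 ∧ insert v τ.1 ∈ K then
      ((-1 : ℤ) ^ (τ.1.filter (fun u => u < v)).card) •
        f ⟨insert v τ.1, h.2, by rw [Finset.card_insert_of_notMem h.1, τ.2.2]⟩
    else 0

/-- Vanishing of the simplicial homology of `K` with coefficients in `G` in
degree `i` (faces of cardinality `i+1`): every cycle is a boundary.
If `∅ ∈ K` this is reduced homology (the boundary map to cardinality-0 chains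
is the augmentation); in degrees `i ≥ 1` reduced and unreduced homology agree. -/
def HomologyZero {V : Type} [Fintype V] [DecidableEq V] [LinearOrder V]
    (K : Finset (Finset V)) (i : ℕ) (G : Type) [AddCommGroup G] : Prop :=
  ∀ f : Chains K (i + 1) G, chainBoundary K i f = 0 →
    ∃ g : Chains K (i + 2) G, chainBoundary K (i + 1) g = f

/-- Vanishing of top-dimensional homology `H_d(K,G)`, i.e. the kernel of the
`d`-th boundary map is zero. -/
def TopHomologyZero {V : Type} [Fintype V] [DecidableEq V] [LinearOrder V]
    (K : Finset (Finset V)) (d : ℕ) (G : Type) [AddCommGroup G] : Prop :=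
  ∀ f : Chains K (d + 1) G, chainBoundary K d f = 0 → f = 0

/-- The boundary map on real coefficients, as a linear map. -/
def chainBoundaryLin {V : Type} [Fintype V] [DecidableEq V] [LinearOrder V]
    (K : Finset (Finset V)) (c : ℕ) : Chains K (c + 1) ℝ →ₗ[ℝ] Chains K c ℝ where
  toFun := chainBoundary K c
  map_add' f g := by
    funext τ
    simp only [chainBoundary, Pi.add_apply]
    rw [← Finset.sum_add_distrib]
    refine Finset.sum_congr rfl fun v _ => ?_
    split
    · simp [smul_add]
    · simp
  map_smul' r f := by
    funext τ
    simp only [chainBoundary, Pi.smul_apply, RingHom.id_apply]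
    rw [Finset.smul_sum]
    refine Finset.sum_congr rfl fun v _ => ?_
    split
    · exact smul_comm _ _ _
    · simp

/-- The `k`-th Betti number of `K`: the dimension of the `k`-th real simplicial
homology, i.e. of (kernel of `∂_k`) / (image of `∂_{k+1}`). -/
def bettiNumber {V : Type} [Fintype V] [DecidableEq V] [LinearOrder V]
    (K : Finset (Finset V)) (k : ℕ) : ℕ :=
  Module.finrank ℝ
    (↥(LinearMap.ker (chainBoundaryLin K k)) ⧸
      (LinearMap.range (chainBoundaryLin K (k + 1))).comap
        (LinearMap.ker (chainBoundaryLin K k)).subtype)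

/-- The link of a face `σ` in the complex `K`. -/
def linkSet {V : Type} [Fintype V] [DecidableEq V]
    (K : Finset (Finset V)) (σ : Finset V) : Finset (Finset V) :=
  Finset.univ.filter fun τ => τ ∩ σ = ∅ ∧ τ ∪ σ ∈ K

/-- The graph underlying the link of a face `σ`: its vertices are the vertices
of the link, joined when they span an edge of the link. -/
def linkGraph {V : Type} [Fintype V] [DecidableEq V]
    (K : Finset (Finset V)) (σ : Finset V) :
    SimpleGraph {v : V // {v} ∈ linkSet K σ} where
  Adj a b := a ≠ b ∧ ({a.1, b.1} : Finset V) ∈ linkSet K σ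
  symm := ⟨fun a b ⟨hab, h⟩ => ⟨hab.symm, by rwa [Finset.pair_comm]⟩⟩
  loopless := ⟨fun a ⟨hab, _⟩ => hab rfl⟩

instance {V : Type} [Fintype V] [DecidableEq V] (K : Finset (Finset V)) (σ : Finset V) :
    DecidableRel (linkGraph K σ).Adj :=
  fun a b => inferInstanceAs (Decidable (a ≠ b ∧ ({a.1, b.1} : Finset V) ∈ linkSet K σ))

/-- The normalized Laplacian `I - D^{-1/2} A D^{-1/2}` of a finite graph. -/
def normalizedLaplacian {W : Type} [Fintype W] [DecidableEq W]
    (H : SimpleGraph W) [DecidableRel H.Adj] : Matrix W W ℝ :=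
  Matrix.of fun a b =>
    (if a = b then (1 : ℝ) else 0) -
      (if H.Adj a b then 1 / Real.sqrt ((H.degree a : ℝ) * (H.degree b : ℝ)) else 0)

/-- An elementary `d`-collapse step: remove a free `(d-1)`-face `σ` together with
the unique `d`-face `τ` containing it. -/
def CollapseStep {V : Type} [DecidableEq V] (d : ℕ) (K K' : Finset (Finset V)) : Prop :=
  ∃ σ τ : Finset V, σ ∈ K ∧ τ ∈ K ∧ τ.card = d + 1 ∧ σ ⊆ τ ∧ σ.card = d ∧
    (∀ ρ ∈ K, σ ⊆ ρ → ρ.card = d + 1 → ρ = τ) ∧ K' = K \ {σ, τ}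

/-- `K` is `d`-collapsible if some finite sequence of elementary collapses reduces it
to a complex of dimension at most `d-1`. -/
def IsDCollapsible {V : Type} [DecidableEq V] (d : ℕ) (K : Finset (Finset V)) : Prop :=
  ∃ K' : Finset (Finset V),
    Relation.ReflTransGen (CollapseStep d) K K' ∧ ∀ s ∈ K', s.card ≤ d

/-- The geometric realization of a complex on vertex set `Fin n`, inside `ℝ^n`:
the union over the faces of the convex hulls of the corresponding standard
basis vectors. -/
def geomReal (n : ℕ) (K : Finset (Finset (Fin n))) : Set (Fin n → ℝ) :=
  ⋃ σ ∈ K, convexHull ℝ ((fun i => (Pi.single i 1 : Fin n → ℝ)) '' ↑σ)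

/-- The boundary of the simplex on the vertex set `τ`, as a chain of cardinality
`c` (to be used with `τ.card = c + 1`): the alternating sum of the `c`-element
subsets of `τ`. -/
def simplexBoundaryChain {V : Type} [Fintype V] [DecidableEq V] [LinearOrder V]
    (K : Finset (Finset V)) (c : ℕ) (τ : Finset V) : Chains K c ℝ :=
  fun σ => ∑ v ∈ τ,
    if σ.1 = τ.erase v then ((-1 : ℝ) ^ (τ.filter (fun u => u < v)).card) else 0

/-- Index type for the multiparameter model: all potential faces of dimension `≥ 1`. -/
abbrev MultiIdx (n : ℕ) : Type := {s : Finset (Fin n) // 2 ≤ s.card}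

/-- The distribution of the multiparameter random complex `X(n; p₁, p₂, …)`:
a potential face of cardinality `i+1` gets an independent Bernoulli(`p i`) coin. -/
def multiMeasure (n : ℕ) (p : ℕ → ℝ) : Measure (MultiIdx n → Bool) :=
  Measure.pi fun t => bernoulliBool (p (t.1.card - 1))

/-- The multiparameter random complex: a set `s` is a face iff every subset of `s`
of dimension `≥ 1` has its coin turned on (this is exactly the
inductive-by-dimension construction: a face is present iff its coin is on and all
of its boundary faces are present). -/
def multiComplex (n : ℕ) (ω : MultiIdx n → Bool) : Finset (Finset (Fin n)) :=
  Finset.univ.filter fun s => ∀ t : MultiIdx n, t.1 ⊆ s → ω t = true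

/-- The Vietoris–Rips complex of the points `pts` at scale `r`. -/
def VRcomplex (n d : ℕ) (pts : Fin n → EuclideanSpace ℝ (Fin d)) (r : ℝ) :
    Finset (Finset (Fin n)) :=
  Finset.univ.filter fun s => ∀ i ∈ s, ∀ j ∈ s, dist (pts i) (pts j) ≤ r

end

noncomputable section
namespace SCT

/-! ### Topology -/
open CategoryTheory in
def hc {X : Type} [TopologicalSpace X] {x y : X} (p : Path x y) :
    (FundamentalGroupoid.mk x) ⟶ (FundamentalGroupoid.mk y) :=
  FundamentalGroupoid.fromPath (Path.Homotopic.Quotient.mk p)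

lemma hc_eq {X : Type} [TopologicalSpace X] {x y : X} {p q : Path x y} :
    hc p = hc q ↔ p.Homotopic q := FundamentalGroupoid.fromPath_eq_iff_homotopic p q

open CategoryTheory in
lemma hc_trans {X : Type} [TopologicalSpace X] {x y z : X} (p : Path x y) (q : Path y z) :
    hc (p.trans q) = hc p ≫ hc q := rfl

open CategoryTheory in
lemma hc_refl {X : Type} [TopologicalSpace X] (x : X) :
    hc (Path.refl x) = 𝟙 _ := rfl

lemma homotopic_of_subset {E : Type} [TopologicalSpace E] {X S : Set E} (hS : S ⊆ X)
    (hsc : SimplyConnectedSpace S) {x y : X} (p q : Path x y)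
    (hp : ∀ t, (p t : E) ∈ S) (hq : ∀ t, (q t : E) ∈ S) : hc p = hc q := by
  rw [hc_eq]
  have hx : (x : E) ∈ S := by simpa using hp 0
  have hy : (y : E) ∈ S := by simpa using hp 1
  let p' : Path (⟨x, hx⟩ : S) ⟨y, hy⟩ :=
    { toFun := fun t => ⟨p t, hp t⟩
      continuous_toFun := by fun_prop
      source' := by simp
      target' := by simp }
  let q' : Path (⟨x, hx⟩ : S) ⟨y, hy⟩ :=
    { toFun := fun t => ⟨q t, hq t⟩
      continuous_toFun := by fun_prop
      source' := by simp
      target' := by simp }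
  have h := SimplyConnectedSpace.paths_homotopic p' q'
  exact h.map ⟨Set.inclusion hS, continuous_inclusion hS⟩

def segPath {E : Type} [AddCommGroup E] [Module ℝ E] [TopologicalSpace E] [ContinuousAdd E]
    [ContinuousSMul ℝ E] {X : Set E} (x y : X)
    (h : ∀ t ∈ Set.Icc (0:ℝ) 1, (1 - t) • (x : E) + t • (y : E) ∈ X) : Path x y where
  toFun t := ⟨(1 - (t : ℝ)) • (x : E) + (t : ℝ) • (y : E), h t t.2⟩
  continuous_toFun := by fun_prop
  source' := by simp
  target' := by simp

variable {n : ℕ} {K : Finset (Finset (Fin n))}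

def simp' (n : ℕ) (σ : Finset (Fin n)) : Set (Fin n → ℝ) :=
  {x | (∀ i, 0 ≤ x i) ∧ ∑ i, x i = 1 ∧ ∀ i, i ∉ σ → x i = 0}

lemma convex_simp' (σ : Finset (Fin n)) : Convex ℝ (simp' n σ) := by
  intro x hx y hy a b ha hb hab
  refine ⟨fun i => ?_, ?_, fun i hi => ?_⟩
  · have := hx.1 i; have := hy.1 i
    simp only [Pi.add_apply, Pi.smul_apply, smul_eq_mul]; positivity
  · simp only [Pi.add_apply, Pi.smul_apply, smul_eq_mul, Finset.sum_add_distrib,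
      ← Finset.mul_sum, hx.2.1, hy.2.1]; linarith
  · simp [hx.2.2 i hi, hy.2.2 i hi]

lemma hull_eq (σ : Finset (Fin n)) :
    convexHull ℝ ((fun i : Fin n => (Pi.single i 1 : Fin n → ℝ)) '' (σ : Set (Fin n)))
      = simp' n σ := by
  apply Set.Subset.antisymm
  · apply convexHull_min _ (convex_simp' σ)
    rintro _ ⟨i, hi, rfl⟩
    refine ⟨fun j => ?_, ?_, fun j hj => ?_⟩
    · simp only [Pi.single_apply]; split_ifs <;> norm_num
    · simp
    · have : j ≠ i := by rintro rfl; exact hj hi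
      simp [this]
  · intro x hx
    have hs : ∑ i ∈ σ, x i = 1 := by
      rw [← hx.2.1]; exact Finset.sum_subset (Finset.subset_univ _) (fun i _ hi => hx.2.2 i hi)
    have : x = ∑ i ∈ σ, x i • (Pi.single i 1 : Fin n → ℝ) := by
      funext j
      simp only [Finset.sum_apply, Pi.smul_apply, Pi.single_apply, smul_eq_mul, mul_ite, mul_one,
        mul_zero, Finset.sum_ite_eq]
      split_ifs with h
      · rfl
      · exact hx.2.2 j h
    rw [this]
    refine (convex_convexHull ℝ _).sum_mem (fun i _ => hx.1 i) hs (fun i hi => ?_)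
    exact subset_convexHull _ _ ⟨i, hi, rfl⟩

lemma mem_geomReal {x : Fin n → ℝ} :
    x ∈ geomReal n K ↔ ∃ σ ∈ K, x ∈ simp' n σ := by
  simp only [geomReal, Set.mem_iUnion, hull_eq, exists_prop]

lemma simp'_subset {σ} (h : σ ∈ K) : simp' n σ ⊆ geomReal n K :=
  fun _ hx => mem_geomReal.2 ⟨σ, h, hx⟩

lemma single_mem {σ : Finset (Fin n)} {v} (hv : v ∈ σ) :
    (Pi.single v 1 : Fin n → ℝ) ∈ simp' n σ := by
  rw [← hull_eq]; exact subset_convexHull _ _ ⟨v, hv, rfl⟩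

lemma sc_simp' {σ : Finset (Fin n)} (h : (simp' n σ).Nonempty) : SimplyConnectedSpace (simp' n σ) := by
  obtain ⟨x, hx⟩ := h
  have := ((convex_simp' σ).starConvex hx).contractibleSpace ⟨x, hx⟩
  infer_instance

def star (n : ℕ) (K : Finset (Finset (Fin n))) (v : Fin n) : Set (Fin n → ℝ) :=
  {x | x ∈ geomReal n K ∧ 0 < x v}

lemma star_conv (v : Fin n) :
    StarConvex ℝ (Pi.single v 1 : Fin n → ℝ) (star n K v) := by
  intro x hx a b ha hb hab
  obtain ⟨hx1, hx2⟩ := hx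
  obtain ⟨σ, hσ, hxs⟩ := mem_geomReal.1 hx1
  have hv : v ∈ σ := by by_contra h; rw [hxs.2.2 v h] at hx2; exact lt_irrefl _ hx2
  refine ⟨mem_geomReal.2 ⟨σ, hσ, convex_simp' σ (single_mem hv) hxs ha hb hab⟩, ?_⟩
  simp only [Pi.add_apply, Pi.smul_apply, Pi.single_eq_same, smul_eq_mul, mul_one]
  rcases ha.eq_or_lt with h | h
  · subst h; have : b = 1 := by linarith
    subst this; linarith
  · have := mul_nonneg hb hx2.le; linarith

lemma star_self (hd : ∀ v, {v} ∈ K) (v : Fin n) :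
    (Pi.single v 1 : Fin n → ℝ) ∈ star n K v :=
  ⟨simp'_subset (hd v) (single_mem (by simp)), by simp⟩

lemma sc_star (hd : ∀ v, {v} ∈ K) (v : Fin n) : SimplyConnectedSpace (star n K v) := by
  have := (star_conv v).contractibleSpace ⟨_, star_self hd v⟩
  infer_instance

lemma exists_star (x : geomReal n K) : ∃ v, 0 < (x : Fin n → ℝ) v := by
  obtain ⟨σ, hσ, hxs⟩ := mem_geomReal.1 x.2
  by_contra! h
  have : ∑ i, (x : Fin n → ℝ) i ≤ 0 := Finset.sum_nonpos (fun i _ => h i)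
  rw [hxs.2.1] at this; linarith

open CategoryTheory in
theorem simplyConnected_of (hn : 0 < n)
    (h2 : ∀ s : Finset (Fin n), s.card ≤ 2 → s ∈ K)
    (hQ : ∀ (Γ : Type) [Groupoid.{0} Γ] (ob : Fin n → Γ) (e : ∀ x y, ob x ⟶ ob y),
      (∀ x y, e x y ≫ e y x = 𝟙 _) → (∀ x y z, {x, y, z} ∈ K → e x y ≫ e y z = e x z) →
      ∀ x y z, e x y ≫ e y z = e x z) :
    SimplyConnectedSpace (geomReal n K) := by
  have hd : ∀ v, {v} ∈ K := fun v => h2 _ (by simp)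
  have hpair : ∀ v w, {v, w} ∈ K := fun v w => h2 _ Finset.card_le_two
  let X := geomReal n K
  let ve : Fin n → X := fun v => ⟨Pi.single v 1, (star_self hd v).1⟩
  have hseg : ∀ (x y : X) (σ : Finset (Fin n)), σ ∈ K → (x : Fin n → ℝ) ∈ simp' n σ →
      (y : Fin n → ℝ) ∈ simp' n σ →
      ∀ t ∈ Set.Icc (0:ℝ) 1, (1 - t) • (x : Fin n → ℝ) + t • (y : Fin n → ℝ) ∈ simp' n σ :=
    fun x y σ hσ hx hy t ht => convex_simp' σ hx hy (by linarith [ht.2]) ht.1 (by ring)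
  have hm : ∀ {v : Fin n} {σ : Finset (Fin n)}, v ∈ σ → ((ve v : X) : Fin n → ℝ) ∈ simp' n σ :=
    fun h => single_mem h
  let ep : ∀ v w, Path (ve v) (ve w) := fun v w => segPath (ve v) (ve w) (fun t ht =>
    simp'_subset (hpair v w) (hseg _ _ _ (hpair v w) (hm (by simp)) (hm (by simp)) t ht))
  have hep : ∀ v w σ, σ ∈ K → v ∈ σ → w ∈ σ → ∀ t, ((ep v w t : X) : Fin n → ℝ) ∈ simp' n σ :=
    fun v w σ hσ hv hw t => hseg _ _ _ hσ (hm hv) (hm hw) t t.2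
  let r : ∀ v (x : X), 0 < (x : Fin n → ℝ) v → Path (ve v) x := fun v x hx =>
    segPath (ve v) x (fun t ht => ((star_conv v) ⟨x.2, hx⟩ (a := 1 - t) (b := t) (by linarith [ht.2]) ht.1 (by ring)).1)
  have hr1 : ∀ v x hx t, ((r v x hx t : X) : Fin n → ℝ) ∈ star n K v := fun v x hx t =>
    ((star_conv v) ⟨x.2, hx⟩ (a := 1 - t) (b := t) (by linarith [t.2.2]) t.2.1 (by ring))
  have trans_in : ∀ {S : Set (Fin n → ℝ)} {x y z : X} (p : Path x y) (q : Path y z),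
      (∀ t, ((p t : X) : Fin n → ℝ) ∈ S) → (∀ t, ((q t : X) : Fin n → ℝ) ∈ S) →
      ∀ t, (((p.trans q) t : X) : Fin n → ℝ) ∈ S := by
    intro S x y z p q hp hq t
    rw [Path.trans_apply]; split_ifs
    · exact hp _
    · exact hq _
  have key : ∀ x y z, hc (ep x y) ≫ hc (ep y z) = hc (ep x z) := by
    refine hQ (FundamentalGroupoid X) (fun v => ⟨ve v⟩) (fun x y => hc (ep x y)) ?_ ?_
    · intro x y
      rw [← hc_trans, ← hc_refl]
      refine homotopic_of_subset (simp'_subset (hpair x y)) (sc_simp' ⟨_, hm (v := x) (by simp)⟩) _ _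
        (trans_in _ _ (hep _ _ _ (hpair x y) (by simp) (by simp)) (hep _ _ _ (hpair x y) (by simp) (by simp))) ?_
      intro t; exact hm (by simp)
    · intro x y z h
      rw [← hc_trans]
      exact homotopic_of_subset (simp'_subset h) (sc_simp' ⟨_, hm (v := x) (by simp)⟩) _ _
        (trans_in _ _ (hep _ _ _ h (by simp) (by simp)) (hep _ _ _ h (by simp) (by simp)))
        (hep _ _ _ h (by simp) (by simp))
  let o : Fin n := ⟨0, hn⟩
  choose vv hvv using (fun x : X => exists_star x)
  let F : ∀ x : X, (FundamentalGroupoid.mk (ve o)) ⟶ (FundamentalGroupoid.mk x) :=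
    fun x => hc (ep o (vv x)) ≫ hc (r (vv x) x (hvv x))
  have hF : ∀ (x : X) v (hv : 0 < (x : Fin n → ℝ) v), F x = hc (ep o v) ≫ hc (r v x hv) := by
    intro x v hv
    obtain ⟨σ, hσ, hxs⟩ := mem_geomReal.1 x.2
    have hσv : ∀ v, 0 < (x : Fin n → ℝ) v → v ∈ σ := by
      intro v hv
      by_contra h; rw [hxs.2.2 v h] at hv; exact lt_irrefl _ hv
    have hrs : ∀ v hv t, ((r v x hv t : X) : Fin n → ℝ) ∈ simp' n σ :=
      fun v hv t => hseg _ _ _ hσ (hm (hσv v hv)) hxs t t.2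
    have h1 : hc (r v x hv) = hc (ep v (vv x)) ≫ hc (r (vv x) x (hvv x)) := by
      rw [← hc_trans]
      exact homotopic_of_subset (simp'_subset hσ) (sc_simp' ⟨_, hxs⟩) _ _ (hrs v hv)
        (trans_in _ _ (hep _ _ _ hσ (hσv _ hv) (hσv _ (hvv x))) (hrs _ (hvv x)))
    rw [h1, ← Category.assoc, key]
  have hloc : ∀ (v) {x y : X} (γ : Path x y), (∀ t, ((γ t : X) : Fin n → ℝ) ∈ star n K v) →
      F x ≫ hc γ = F y := by
    intro v x y γ hγ
    have hx : 0 < (x : Fin n → ℝ) v := by simpa using (hγ 0).2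
    have hy : 0 < (y : Fin n → ℝ) v := by simpa using (hγ 1).2
    rw [hF x v hx, hF y v hy, Category.assoc]
    congr 1
    rw [← hc_trans]
    exact homotopic_of_subset (fun z hz => hz.1) (sc_star hd v) _ _ (trans_in _ _ (hr1 v x hx) hγ) (hr1 v y hy)
  have hglob : ∀ {x y : X} (γ : Path x y), F x ≫ hc γ = F y := by
    intro x y γ
    obtain ⟨t, ht0, htm, ⟨N, hN⟩, htc⟩ := exists_monotone_Icc_subset_open_cover_unitInterval
      (c := fun v : Fin n => {s : unitInterval | 0 < ((γ s : X) : Fin n → ℝ) v})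
      (fun v => isOpen_lt continuous_const ((continuous_apply v).comp (continuous_subtype_val.comp γ.continuous)))
      (fun s _ => by
        obtain ⟨v, hv⟩ := exists_star (γ s)
        exact Set.mem_iUnion.2 ⟨v, hv⟩)
    have ind : ∀ m, F (γ 0) ≫ hc (γ.subpath 0 (t m)) = F (γ (t m)) := by
      intro m
      induction m with
      | zero =>
        rw [ht0, Path.subpath_self, hc_refl, Category.comp_id]
      | succ m ih =>
        have h1 : hc (γ.subpath 0 (t (m+1))) =
            hc (γ.subpath 0 (t m)) ≫ hc (γ.subpath (t m) (t (m+1))) := by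
          rw [← hc_trans]; symm; rw [hc_eq]
          exact ⟨Path.Homotopy.subpathTransSubpath γ _ _ _⟩
        rw [h1, ← Category.assoc, ih]
        obtain ⟨v, hv⟩ := htc m
        refine hloc v _ (fun s => ⟨Subtype.property _, ?_⟩)
        have : (γ.subpath (t m) (t (m+1))) s ∈ Set.range (γ.subpath (t m) (t (m+1))) := ⟨s, rfl⟩
        rw [Path.range_subpath_of_le _ _ _ (htm (Nat.le_succ m))] at this
        obtain ⟨s', hs', hs2⟩ := this
        rw [← hs2]; exact hv hs'
    have h1 := ind N
    rw [hN N le_rfl, Path.subpath_zero_one] at h1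
    have gen : ∀ x' y' (h0 : x' = x) (h1 : y' = y), F x' ≫ hc (γ.cast h0 h1) = F y' →
        F x ≫ hc γ = F y := by
      rintro x' y' rfl rfl h; exact h
    exact gen _ _ _ _ h1
  rw [simply_connected_iff_paths_homotopic']
  refine ⟨⟨⟨ve o⟩, ?_⟩, ?_⟩
  · have : ∀ x : X, Joined (ve o) x := fun x =>
      ⟨(ep o (vv x)).trans (r (vv x) x (hvv x))⟩
    exact fun x y => (this x).symm.trans (this y)
  · intro x y p q
    rw [← hc_eq, ← cancel_epi (F x), hglob, hglob]

end SCT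
end

noncomputable section
namespace SCT

/-! ### Labelled stacked trees -/
inductive LT (V : Type) : Type
  | leaf : LT V
  | node : V → LT V → LT V → LT V → LT V

namespace LT
variable {V : Type} [DecidableEq V]

def faces : LT V → V → V → V → Finset (Finset V)
  | leaf, x, y, z => {{x, y, z}}
  | node v t0 t1 t2, x, y, z => faces t0 v y z ∪ faces t1 x v z ∪ faces t2 x y v

def labs : LT V → Finset V
  | leaf => ∅
  | node v t0 t1 t2 => insert v (labs t0 ∪ labs t1 ∪ labs t2)

def sz : LT V → ℕ
  | leaf => 0
  | node _ t0 t1 t2 => 1 + sz t0 + sz t1 + sz t2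

def ok : Finset V → LT V → Prop
  | _, leaf => True
  | U, node v t0 t1 t2 => v ∉ U ∧ ok (insert v U) t0 ∧ ok (insert v U) t1 ∧ ok (insert v U) t2 ∧
      Disjoint (labs t0) (labs t1) ∧ Disjoint (labs t0) (labs t2) ∧ Disjoint (labs t1) (labs t2)

lemma ok_disj {U : Finset V} {t : LT V} (h : ok U t) : ∀ l ∈ labs t, l ∉ U := by
  induction t generalizing U with
  | leaf => simp [labs]
  | node v t0 t1 t2 h0 h1 h2 =>
    obtain ⟨hv, k0, k1, k2, -⟩ := h
    have := h0 k0; have := h1 k1; have := h2 k2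
    simp only [labs, mem_insert, mem_union] at *
    grind

lemma ok_union {U W : Finset V} {t : LT V} (h : ok (U ∪ W) t) : ok U t ∧ Disjoint W (labs t) := by
  refine ⟨?_, ?_⟩
  · induction t generalizing U with
    | leaf => trivial
    | node v t0 t1 t2 h0 h1 h2 =>
      obtain ⟨hv, k0, k1, k2, k⟩ := h
      rw [← insert_union] at k0 k1 k2
      exact ⟨fun h => hv (mem_union_left _ h), h0 k0, h1 k1, h2 k2, k⟩
  · rw [Finset.disjoint_left]
    intro a ha hb
    exact ok_disj h a hb (mem_union_right _ ha)

lemma ok_mono {U W : Finset V} {t : LT V} (hUW : W ⊆ U) (h : ok U t) : ok W t := by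
  rw [← Finset.union_sdiff_of_subset hUW] at h
  exact (ok_union h).1

lemma card_labs (t : LT V) : (labs t).card ≤ sz t := by
  induction t with
  | leaf => simp [labs]
  | node v t0 t1 t2 h0 h1 h2 =>
    simp only [labs, sz]
    have := card_insert_le v (labs t0 ∪ labs t1 ∪ labs t2)
    have := card_union_le (labs t0 ∪ labs t1) (labs t2)
    have := card_union_le (labs t0) (labs t1)
    omega

lemma card_faces (t : LT V) (x y z : V) : (faces t x y z).card ≤ 2 * sz t + 1 := by
  induction t generalizing x y z with
  | leaf => simp [faces]
  | node v t0 t1 t2 h0 h1 h2 =>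
    simp only [faces, sz]
    have := h0 v y z
    have := h1 x v z
    have := h2 x y v
    have := card_union_le (faces t0 v y z ∪ faces t1 x v z) (faces t2 x y v)
    have := card_union_le (faces t0 v y z) (faces t1 x v z)
    omega

lemma faces_sub (t : LT V) (x y z : V) {f : Finset V} (hf : f ∈ faces t x y z) :
    f ⊆ {x, y, z} ∪ labs t := by
  induction t generalizing x y z with
  | leaf => simp [faces] at hf; simp [labs, hf]
  | node v t0 t1 t2 h0 h1 h2 =>
    simp only [faces, mem_union] at hf
    simp only [labs]
    rcases hf with (hf | hf) | hf
    · have := h0 _ _ _ hf; grind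
    · have := h1 _ _ _ hf; grind
    · have := h2 _ _ _ hf; grind

/-- boundary is good for `U` -/
def bd (U : Finset V) (x y z : V) : Prop := x ∈ U ∧ y ∈ U ∧ z ∈ U ∧ x ≠ y ∧ y ≠ z ∧ x ≠ z

lemma bd0 {U : Finset V} {x y z v : V} (h : bd U x y z) (hv : v ∉ U) : bd (insert v U) v y z := by
  unfold bd at *; grind
lemma bd1 {U : Finset V} {x y z v : V} (h : bd U x y z) (hv : v ∉ U) : bd (insert v U) x v z := by
  unfold bd at *; grind
lemma bd2 {U : Finset V} {x y z v : V} (h : bd U x y z) (hv : v ∉ U) : bd (insert v U) x y v := by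
  unfold bd at *; grind

lemma faces_card {U : Finset V} {t : LT V} (h : ok U t) {x y z : V} (hb : bd U x y z)
    {f : Finset V} (hf : f ∈ faces t x y z) : f.card = 3 := by
  induction t generalizing U x y z with
  | leaf =>
    simp [faces] at hf; subst hf
    exact card_eq_three.2 ⟨x, y, z, hb.2.2.2.1, hb.2.2.2.2.2, hb.2.2.2.2.1, rfl⟩
  | node v t0 t1 t2 h0 h1 h2 =>
    obtain ⟨hv, k0, k1, k2, k⟩ := h
    simp only [faces, mem_union] at hf
    rcases hf with (hf | hf) | hf
    · exact h0 k0 (bd0 hb hv) hf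
    · exact h1 k1 (bd1 hb hv) hf
    · exact h2 k2 (bd2 hb hv) hf

lemma edge_cov (t : LT V) (x y z : V) :
    (∃ f ∈ faces t x y z, x ∈ f ∧ y ∈ f) ∧ (∃ f ∈ faces t x y z, y ∈ f ∧ z ∈ f) ∧
    (∃ f ∈ faces t x y z, x ∈ f ∧ z ∈ f) := by
  induction t generalizing x y z with
  | leaf => simp [faces]
  | node v t0 t1 t2 h0 h1 h2 =>
    simp only [faces, mem_union]
    have := (h0 v y z).2.1
    have := (h1 x v z).2.2
    have := (h2 x y v).1
    grind

/-- intersection of two different "cells" has at most two elements -/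
lemma two_of {f : Finset V} {a b : V} (h : ∀ x ∈ f, x = a ∨ x = b) : f.card ≤ 2 := by
  have : f ⊆ {a, b} := fun x hx => by simpa using h x hx
  exact (card_le_card this).trans card_le_two

lemma cell_disj {U : Finset V} {v : V} {t0 t1 t2 : LT V} (h : ok U (node v t0 t1 t2)) {x y z : V}
    (hb : bd U x y z) :
    Disjoint (faces t0 v y z) (faces t1 x v z) ∧ Disjoint (faces t0 v y z) (faces t2 x y v) ∧
    Disjoint (faces t1 x v z) (faces t2 x y v) := by
  obtain ⟨hv, k0, k1, k2, d01, d02, d12⟩ := h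
  have e0 := ok_disj k0
  have e1 := ok_disj k1
  have e2 := ok_disj k2
  simp only [Finset.disjoint_left] at *
  have hb' := hb
  unfold bd at hb'
  refine ⟨fun f hf hg => ?_, fun f hf hg => ?_, fun f hf hg => ?_⟩
  · have a1 := faces_sub _ _ _ _ hf
    have a2 := faces_sub _ _ _ _ hg
    have a3 := faces_card k0 (bd0 hb hv) hf
    have := two_of (f := f) (a := v) (b := z) (fun q hq => by
      have := a1 hq; have := a2 hq; grind)
    omega
  · have a1 := faces_sub _ _ _ _ hf
    have a2 := faces_sub _ _ _ _ hg
    have a3 := faces_card k0 (bd0 hb hv) hf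
    have := two_of (f := f) (a := v) (b := y) (fun q hq => by
      have := a1 hq; have := a2 hq; grind)
    omega
  · have a1 := faces_sub _ _ _ _ hf
    have a2 := faces_sub _ _ _ _ hg
    have a3 := faces_card k1 (bd1 hb hv) hf
    have := two_of (f := f) (a := v) (b := x) (fun q hq => by
      have := a1 hq; have := a2 hq; grind)
    omega

/-- indicator of being outside `I` -/
def ind (I : Finset V) (x : V) : ℕ := if x ∈ I then 0 else 1

/-- number of labels outside `I` -/
def nw (I : Finset V) : LT V → ℕ
  | leaf => 0
  | node v t0 t1 t2 => ind I v + nw I t0 + nw I t1 + nw I t2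

lemma ind_zero {I : Finset V} {x : V} (h : x ∈ I) : ind I x = 0 := by simp [ind, h]
lemma ind_le {I : Finset V} {x : V} : ind I x ≤ 1 := by unfold ind; split_ifs <;> simp
lemma ind_one {I : Finset V} {x : V} (h : ind I x ≠ 0) : x ∉ I := fun h' => h (ind_zero h')

lemma card_node {U : Finset V} {v : V} {t0 t1 t2 : LT V} (h : ok U (node v t0 t1 t2)) {x y z : V}
    (hb : bd U x y z) (X : Finset (Finset V)) :
    (faces (node v t0 t1 t2) x y z \ X).card =
      (faces t0 v y z \ X).card + (faces t1 x v z \ X).card + (faces t2 x y v \ X).card := by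
  obtain ⟨a, b, c⟩ := cell_disj h hb
  simp only [faces]
  rw [union_sdiff_distrib, union_sdiff_distrib, card_union_of_disjoint, card_union_of_disjoint]
  · exact disjoint_of_subset_left sdiff_subset (disjoint_of_subset_right sdiff_subset a)
  · rw [disjoint_union_left]
    exact ⟨disjoint_of_subset_left sdiff_subset (disjoint_of_subset_right sdiff_subset b),
      disjoint_of_subset_left sdiff_subset (disjoint_of_subset_right sdiff_subset c)⟩

lemma bdry_in {I : Finset V} {X : Finset (Finset V)} (hX : ∀ f ∈ X, f ⊆ I) {t : LT V} {x y z : V}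
    (h : faces t x y z ⊆ X) : x ∈ I ∧ y ∈ I ∧ z ∈ I := by
  obtain ⟨⟨f, hf, h1, h2⟩, ⟨g, hg, h3, h4⟩, -⟩ := edge_cov t x y z
  exact ⟨hX f (h hf) h1, hX f (h hf) h2, hX g (h hg) h4⟩

lemma lemma1 {I : Finset V} {X : Finset (Finset V)} (hX : ∀ f ∈ X, f ⊆ I) {U : Finset V} {t : LT V}
    (h : ok U t) {x y z : V} (hb : bd U x y z) :
    (faces t x y z ⊆ X ∧ nw I t = 0) ∨ 2 * nw I t + 1 ≤ (faces t x y z \ X).card := by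
  induction t generalizing U x y z with
  | leaf =>
    by_cases hh : {x, y, z} ∈ X
    · left; simp [faces, nw, hh]
    · right; simp [faces, nw, sdiff_eq_filter, Finset.filter_singleton, hh]
  | node v t0 t1 t2 h0 h1 h2 =>
    have hc := card_node h hb X
    obtain ⟨hv, k0, k1, k2, k⟩ := h
    have i0 := h0 k0 (bd0 hb hv)
    have i1 := h1 k1 (bd1 hb hv)
    have i2 := h2 k2 (bd2 hb hv)
    have j0 : faces t0 v y z ⊆ X → ind I v = 0 := fun hh => ind_zero (bdry_in hX hh).1
    have j1 : faces t1 x v z ⊆ X → ind I v = 0 := fun hh => ind_zero (bdry_in hX hh).2.1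
    have j2 : faces t2 x y v ⊆ X → ind I v = 0 := fun hh => ind_zero (bdry_in hX hh).2.2
    have hi := ind_le (I := I) (x := v)
    rw [hc]
    simp only [nw]
    by_cases a0 : faces t0 v y z ⊆ X <;> by_cases a1 : faces t1 x v z ⊆ X <;>
      by_cases a2 : faces t2 x y v ⊆ X <;> simp only [a0, a1, a2, true_and, false_and, false_or, true_implies, false_implies] at i0 i1 i2 j0 j1 j2
    · left
      refine ⟨?_, ?_⟩
      · simp only [faces]; exact union_subset (union_subset a0 a1) a2
      · have e0 : faces t0 v y z \ X = ∅ := sdiff_eq_empty_iff_subset.2 a0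
        have e1 : faces t1 x v z \ X = ∅ := sdiff_eq_empty_iff_subset.2 a1
        have e2 : faces t2 x y v \ X = ∅ := sdiff_eq_empty_iff_subset.2 a2
        rw [e0] at i0; rw [e1] at i1; rw [e2] at i2
        simp at i0 i1 i2; omega
    all_goals right; omega

lemma lemma2 {I : Finset V} {X : Finset (Finset V)} (hX : ∀ f ∈ X, f ⊆ I) {U : Finset V} {t : LT V}
    (h : ok U t) {x y z : V} (hb : bd U x y z) (hf : ∃ f ∈ faces t x y z, f ∈ X) :
    2 * (nw I t + ind I x + ind I y + ind I z) ≤ (faces t x y z \ X).card := by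
  induction t generalizing U x y z with
  | leaf =>
    obtain ⟨f, hf, hfX⟩ := hf
    simp only [faces, mem_singleton] at hf; subst hf
    have := hX _ hfX
    simp only [insert_subset_iff, singleton_subset_iff] at this
    simp [nw, ind, this]
  | node v t0 t1 t2 h0 h1 h2 =>
    have hc := card_node h hb X
    obtain ⟨hv, k0, k1, k2, k⟩ := h
    have i0 := h0 k0 (bd0 hb hv)
    have i1 := h1 k1 (bd1 hb hv)
    have i2 := h2 k2 (bd2 hb hv)
    have l0 := lemma1 hX k0 (bd0 hb hv)
    have l1 := lemma1 hX k1 (bd1 hb hv)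
    have l2 := lemma1 hX k2 (bd2 hb hv)
    have j0 : faces t0 v y z ⊆ X → ind I v = 0 ∧ ind I y = 0 ∧ ind I z = 0 := fun hh =>
      ⟨ind_zero (bdry_in hX hh).1, ind_zero (bdry_in hX hh).2.1, ind_zero (bdry_in hX hh).2.2⟩
    have j1 : faces t1 x v z ⊆ X → ind I x = 0 ∧ ind I v = 0 ∧ ind I z = 0 := fun hh =>
      ⟨ind_zero (bdry_in hX hh).1, ind_zero (bdry_in hX hh).2.1, ind_zero (bdry_in hX hh).2.2⟩
    have j2 : faces t2 x y v ⊆ X → ind I x = 0 ∧ ind I y = 0 ∧ ind I v = 0 := fun hh =>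
      ⟨ind_zero (bdry_in hX hh).1, ind_zero (bdry_in hX hh).2.1, ind_zero (bdry_in hX hh).2.2⟩
    have hi := ind_le (I := I) (x := x)
    have hi := ind_le (I := I) (x := y)
    have hi := ind_le (I := I) (x := z)
    rw [hc]
    simp only [nw]
    obtain ⟨f, hf, hfX⟩ := hf
    simp only [faces, mem_union] at hf
    rcases hf with (hf | hf) | hf
    · have := i0 ⟨f, hf, hfX⟩
      rcases l1 with ⟨l1, l1'⟩ | l1 <;> rcases l2 with ⟨l2, l2'⟩ | l2 <;> grind
    · have := i1 ⟨f, hf, hfX⟩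
      rcases l0 with ⟨l1, l1'⟩ | l1 <;> rcases l2 with ⟨l2, l2'⟩ | l2 <;> grind
    · have := i2 ⟨f, hf, hfX⟩
      rcases l0 with ⟨l0, l0'⟩ | l0 <;> rcases l1 with ⟨l1, l1'⟩ | l1 <;> grind

/-- containment of cells -/
lemma loc {v : V} {t0 t1 t2 : LT V} {x y z : V} {f : Finset V}
    (hf : f ∈ faces (node v t0 t1 t2) x y z) :
    f ⊆ {v, y, z} ∪ labs t0 ∨ f ⊆ {x, v, z} ∪ labs t1 ∨ f ⊆ {x, y, v} ∪ labs t2 := by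
  simp only [faces, mem_union] at hf
  rcases hf with (hf | hf) | hf
  · exact Or.inl (faces_sub _ _ _ _ hf)
  · exact Or.inr (Or.inl (faces_sub _ _ _ _ hf))
  · exact Or.inr (Or.inr (faces_sub _ _ _ _ hf))

lemma spread {C : Finset V} {L : Finset V} (g : LT V) {p q r : V}
    (hF : ∀ f ∈ faces g p q r, ∀ a ∈ f, a ∈ L → ∀ b ∈ f, b ∈ L ∨ b ∈ C)
    (hl : ∀ l ∈ labs g, l ∉ C) (hb : p ∈ L ∨ q ∈ L ∨ r ∈ L) : labs g ⊆ L := by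
  induction g generalizing p q r with
  | leaf => simp [labs]
  | node w g0 g1 g2 h0 h1 h2 =>
    have c0 := edge_cov g0 w q r
    have c1 := edge_cov g1 p w r
    simp only [faces, mem_union] at hF
    simp only [labs, mem_insert, mem_union] at hl
    have hw : w ∈ L := by
      have := hl w (Or.inl rfl)
      rcases hb with hb | hb | hb
      · obtain ⟨f, hf, hp, hq⟩ := c1.1; grind
      · obtain ⟨f, hf, hp, hq⟩ := c0.1; grind
      · obtain ⟨f, hf, hp, hq⟩ := c0.2.2; grind
    have k0 := h0 (fun f hf => hF f (Or.inl (Or.inl hf))) (fun l hl' => hl l (by grind)) (Or.inl hw)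
    have k1 := h1 (fun f hf => hF f (Or.inl (Or.inr hf))) (fun l hl' => hl l (by grind)) (Or.inr (Or.inl hw))
    have k2 := h2 (fun f hf => hF f (Or.inr hf)) (fun l hl' => hl l (by grind)) (Or.inr (Or.inr hw))
    simp only [labs]
    exact insert_subset hw (union_subset (union_subset k0 k1) k2)

lemma spread' {C : Finset V} {L : Finset V} (g : LT V) {p q r : V}
    (hF : ∀ f ∈ faces g p q r, ∀ a ∈ f, a ∈ L → ∀ b ∈ f, b ∈ L ∨ b ∈ C)
    (hl : ∀ l ∈ labs g, l ∉ C)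
    (hroot : ∀ w, w ∉ C → (∃ f ∈ faces g p q r, p ∈ f ∧ w ∈ f) → (∃ f ∈ faces g p q r, q ∈ f ∧ w ∈ f) →
      (∃ f ∈ faces g p q r, r ∈ f ∧ w ∈ f) → w ∈ L) : labs g ⊆ L := by
  cases g with
  | leaf => simp [labs]
  | node w g0 g1 g2 =>
    have c0 := edge_cov g0 w q r
    have c1 := edge_cov g1 p w r
    have hw : w ∈ L := by
      apply hroot w (hl w (by simp [labs])) <;> simp only [faces, mem_union] <;> grind
    simp only [faces, mem_union] at hF
    simp only [labs, mem_insert, mem_union] at hl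
    have k0 := spread g0 (fun f hf => hF f (Or.inl (Or.inl hf))) (fun l hl' => hl l (by grind)) (Or.inl hw)
    have k1 := spread g1 (fun f hf => hF f (Or.inl (Or.inr hf))) (fun l hl' => hl l (by grind)) (Or.inr (Or.inl hw))
    have k2 := spread g2 (fun f hf => hF f (Or.inr hf)) (fun l hl' => hl l (by grind)) (Or.inr (Or.inr hw))
    simp only [labs]
    exact insert_subset hw (union_subset (union_subset k0 k1) k2)

lemma pinA {A B C L D f : Finset V} (hl : f ⊆ A ∪ L ∨ f ⊆ B ∨ f ⊆ C) (hA : A ⊆ D)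
    (hB : ∀ a ∈ L, a ∉ B) (hC : ∀ a ∈ L, a ∉ C) {a b : V} (ha : a ∈ f) (haL : a ∈ L) (hb : b ∈ f) :
    b ∈ L ∨ b ∈ D := by
  rcases hl with l | l | l
  · have := l hb; grind
  · exact absurd (l ha) (hB a haL)
  · exact absurd (l ha) (hC a haL)

lemma pinB {A A' A'' L L' D f : Finset V} (hl : f ⊆ A ∨ f ⊆ A' ∪ L ∨ f ⊆ A'' ∪ L') (hA : A' ⊆ D)
    (hB : A'' ⊆ D) {x w : V} (hx : x ∉ A) (hxf : x ∈ f) (hw : w ∈ f) (hwD : w ∉ D) :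
    w ∈ L ∨ w ∈ L' := by
  rcases hl with l | l | l
  · exact absurd (l hxf) hx
  · have := l hw; grind
  · have := l hw; grind

lemma pinC {A B L L' f : Finset V} {a b : V} (h1 : f ⊆ A ∪ L) (h2 : f ⊆ B ∪ L') (hc : f.card = 3)
    (hAB : ∀ q ∈ A, q ∈ B → q = a ∨ q = b) (hA : ∀ q ∈ A, q ∉ L') (hB : ∀ q ∈ B, q ∉ L)
    (hL : ∀ q ∈ L, q ∉ L') : False := by
  have := two_of (f := f) (a := a) (b := b) (fun q hq => by
            have := h1 hq; have := h2 hq; grind)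
  omega

lemma pinD {L L' : Finset V} {p q r : V} (h : ∀ a ∈ L, a ∉ L') (hp : p ∉ L) (hq : q ∉ L)
    (hr : r ∉ L) : ∀ a ∈ L, a ∉ ({p, q, r} : Finset V) ∪ L' := by
  intro a ha
  simp only [mem_union, mem_insert, mem_singleton, not_or]
  refine ⟨⟨?_, ?_, ?_⟩, h a ha⟩ <;> rintro rfl <;> contradiction

lemma uniq {U : Finset V} {t t' : LT V} (h : ok U t) (h' : ok U t') {x y z : V} (hb : bd U x y z)
    (hs : faces t' x y z ⊆ faces t x y z) : t' = t := by
  induction t generalizing U t' x y z with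
  | leaf =>
    cases t' with
    | leaf => rfl
    | node v' t0' t1' t2' =>
      exfalso
      obtain ⟨f, hf, h1, h2⟩ := (edge_cov t0' v' y z).1
      have : f ∈ faces (leaf : LT V) x y z := hs (by simp [faces, hf])
      simp only [faces, mem_singleton] at this
      subst this
      have := h'.1
      unfold bd at hb
      grind
  | node v t0 t1 t2 h0 h1 h2 =>
    have hloc : ∀ f ∈ faces t' x y z, _ := fun f hf => loc (hs hf)
    obtain ⟨hv, k0, k1, k2, d01, d02, d12⟩ := h
    have e0 := ok_disj k0
    have e1 := ok_disj k1
    have e2 := ok_disj k2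
    have hb' := hb
    obtain ⟨xU, yU, zU, xy, yz, xz⟩ := hb'
    simp only [Finset.disjoint_left] at d01 d02 d12
    have n0 : v ∉ labs t0 ∧ x ∉ labs t0 ∧ y ∉ labs t0 ∧ z ∉ labs t0 := by
      clear h0 h1 h2 hloc hs; grind
    have n1 : v ∉ labs t1 ∧ x ∉ labs t1 ∧ y ∉ labs t1 ∧ z ∉ labs t1 := by
      clear h0 h1 h2 hloc hs; grind
    have n2 : v ∉ labs t2 ∧ x ∉ labs t2 ∧ y ∉ labs t2 ∧ z ∉ labs t2 := by
      clear h0 h1 h2 hloc hs; grind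
    have hvx : v ≠ x ∧ v ≠ y ∧ v ≠ z := by clear h0 h1 h2 hloc hs; grind
    cases t' with
    | leaf =>
      exfalso
      have := hloc {x, y, z} (by simp [faces])
      simp only [insert_subset_iff, singleton_subset_iff, mem_union, mem_insert, mem_singleton] at this
      clear h0 h1 h2 hloc hs
      grind
    | node v' t0' t1' t2' =>
      obtain ⟨hv', k0', k1', k2', -⟩ := h'
      have F0 : ∀ f ∈ faces t0' v' y z, f ∈ faces (node v' t0' t1' t2') x y z := fun f hf => by simp [faces, hf]
      have F1 : ∀ f ∈ faces t1' x v' z, f ∈ faces (node v' t0' t1' t2') x y z := fun f hf => by simp [faces, hf]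
      have F2 : ∀ f ∈ faces t2' x y v', f ∈ faces (node v' t0' t1' t2') x y z := fun f hf => by simp [faces, hf]
      have A0 : ∀ f ∈ faces (node v' t0' t1' t2') x y z, ∀ a ∈ f, a ∈ labs t0 → ∀ b ∈ f, b ∈ labs t0 ∨ b ∈ ({v, x, y, z} : Finset V) := by
        intro f hf a ha hal b hbf
        exact pinA (hloc f hf) (by simp [insert_subset_iff]) (pinD (fun a h => d01 h) n0.2.1 n0.1 n0.2.2.2) (pinD (fun a h => d02 h) n0.2.1 n0.2.2.1 n0.1) ha hal hbf
      have A1 : ∀ f ∈ faces (node v' t0' t1' t2') x y z, ∀ a ∈ f, a ∈ labs t1 → ∀ b ∈ f, b ∈ labs t1 ∨ b ∈ ({v, x, y, z} : Finset V) := by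
        intro f hf a ha hal b hbf
        exact pinA (or_left_comm.1 (hloc f hf)) (by simp [insert_subset_iff]) (pinD (fun a h h2 => d01 h2 h) n1.1 n1.2.2.1 n1.2.2.2) (pinD (fun a h => d12 h) n1.2.1 n1.2.2.1 n1.1) ha hal hbf
      have A2 : ∀ f ∈ faces (node v' t0' t1' t2') x y z, ∀ a ∈ f, a ∈ labs t2 → ∀ b ∈ f, b ∈ labs t2 ∨ b ∈ ({v, x, y, z} : Finset V) := by
        intro f hf a ha hal b hbf
        exact pinA (or_rotate.2 (hloc f hf)) (by simp [insert_subset_iff]) (pinD (fun a h h2 => d02 h2 h) n2.1 n2.2.2.1 n2.2.2.2) (pinD (fun a h h2 => d12 h2 h) n2.2.1 n2.1 n2.2.2.2) ha hal hbf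
      have Bx : ∀ w, w ∉ ({v, x, y, z} : Finset V) → ∀ f ∈ faces (node v' t0' t1' t2') x y z, x ∈ f → w ∈ f → w ∈ labs t1 ∨ w ∈ labs t2 := by
        intro w hw f hf hx hwf
        exact pinB (hloc f hf) (by simp [insert_subset_iff]) (by simp [insert_subset_iff]) (by simp [n0, hvx.1.symm, xy, xz]) hx hwf hw
      have By : ∀ w, w ∉ ({v, x, y, z} : Finset V) → ∀ f ∈ faces (node v' t0' t1' t2') x y z, y ∈ f → w ∈ f → w ∈ labs t0 ∨ w ∈ labs t2 := by
        intro w hw f hf hx hwf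
        exact pinB (or_left_comm.1 (hloc f hf)) (by simp [insert_subset_iff]) (by simp [insert_subset_iff]) (by simp [n1, xy.symm, yz, hvx.2.1.symm]) hx hwf hw
      have Bz : ∀ w, w ∉ ({v, x, y, z} : Finset V) → ∀ f ∈ faces (node v' t0' t1' t2') x y z, z ∈ f → w ∈ f → w ∈ labs t0 ∨ w ∈ labs t1 := by
        intro w hw f hf hx hwf
        exact pinB (or_rotate.2 (hloc f hf)) (by simp [insert_subset_iff]) (by simp [insert_subset_iff]) (by simp [n2, xz.symm, yz.symm, hvx.2.2.symm]) hx hwf hw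
      have fin : ∀ w, (w ∈ labs t1 ∨ w ∈ labs t2) → (w ∈ labs t0 ∨ w ∈ labs t2) → (w ∈ labs t0 ∨ w ∈ labs t1) → False := by
        clear h0 h1 h2 hloc hs F0 F1 F2 A0 A1 A2 Bx By Bz; grind
      have hvv : v' = v := by
        by_contra hne
        have hw : v' ∉ ({v, x, y, z} : Finset V) := by
          simp only [mem_insert, mem_singleton, not_or]
          exact ⟨hne, fun h => hv' (h ▸ xU), fun h => hv' (h ▸ yU), fun h => hv' (h ▸ zU)⟩
        obtain ⟨f, hf, hf1, hf2⟩ := (edge_cov t0' v' y z).1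
        obtain ⟨g, hg, hg1, hg2⟩ := (edge_cov t0' v' y z).2.2
        obtain ⟨k, hk, hk1, hk2⟩ := (edge_cov t1' x v' z).1
        exact fin v' (Bx v' hw k (F1 k hk) hk1 hk2) (By v' hw f (F0 f hf) hf2 hf1)
          (Bz v' hw g (F0 g hg) hg2 hg1)
      subst hvv
      have e0' := ok_disj k0'
      have e1' := ok_disj k1'
      have e2' := ok_disj k2'
      have hC : ∀ l, l ∉ insert v' U → l ∉ ({v', x, y, z} : Finset V) := by
        intro l hl; simp only [mem_insert, mem_singleton, not_or] at hl ⊢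
        exact ⟨hl.1, fun h => hl.2 (h ▸ xU), fun h => hl.2 (h ▸ yU), fun h => hl.2 (h ▸ zU)⟩
      have L0 : labs t0' ⊆ labs t0 := by
        refine spread' (C := {v', x, y, z}) t0' (fun f hf => A0 f (F0 f hf)) (fun l hl => hC l (e0' l hl)) ?_
        rintro w hw - ⟨f, hf, f1, f2⟩ ⟨g, hg, g1, g2⟩
        rcases By w hw f (F0 f hf) f1 f2 with a | a
        · exact a
        · rcases Bz w hw g (F0 g hg) g1 g2 with b | b
          · exact b
          · exact (d12 b a).elim
      have L1 : labs t1' ⊆ labs t1 := by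
        refine spread' (C := {v', x, y, z}) t1' (fun f hf => A1 f (F1 f hf)) (fun l hl => hC l (e1' l hl)) ?_
        rintro w hw ⟨f, hf, f1, f2⟩ - ⟨g, hg, g1, g2⟩
        rcases Bx w hw f (F1 f hf) f1 f2 with a | a
        · exact a
        · rcases Bz w hw g (F1 g hg) g1 g2 with b | b
          · exact (d02 b a).elim
          · exact b
      have L2 : labs t2' ⊆ labs t2 := by
        refine spread' (C := {v', x, y, z}) t2' (fun f hf => A2 f (F2 f hf)) (fun l hl => hC l (e2' l hl)) ?_
        rintro w hw ⟨f, hf, f1, f2⟩ ⟨g, hg, g1, g2⟩ -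
        rcases Bx w hw f (F2 f hf) f1 f2 with a | a
        · rcases By w hw g (F2 g hg) g1 g2 with b | b
          · exact (d01 b a).elim
          · exact b
        · exact a
      have s0 : faces t0' v' y z ⊆ faces t0 v' y z := by
        intro f hf
        have a1 := (faces_sub _ _ _ _ hf).trans (union_subset_union_right L0)
        have a3 := faces_card k0' (bd0 hb hv) hf
        have a4 := hs (F0 f hf)
        simp only [faces, mem_union] at a4
        rcases a4 with (a4 | a4) | a4
        · exact a4
        · refine (pinC (a := v') (b := z) a1 (faces_sub _ _ _ _ a4) a3 ?_ ?_ ?_ ?_).elim <;>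
            clear h0 h1 h2 hloc hs F0 F1 F2 A0 A1 A2 Bx By Bz fin hb k0 k1 k2 k0' k1' k2' e0 e1 e2 e0' e1' e2' hC L0 L1 L2 <;> grind
        · refine (pinC (a := v') (b := y) a1 (faces_sub _ _ _ _ a4) a3 ?_ ?_ ?_ ?_).elim <;>
            clear h0 h1 h2 hloc hs F0 F1 F2 A0 A1 A2 Bx By Bz fin hb k0 k1 k2 k0' k1' k2' e0 e1 e2 e0' e1' e2' hC L0 L1 L2 <;> grind
      have s1 : faces t1' x v' z ⊆ faces t1 x v' z := by
        intro f hf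
        have a1 := (faces_sub _ _ _ _ hf).trans (union_subset_union_right L1)
        have a3 := faces_card k1' (bd1 hb hv) hf
        have a4 := hs (F1 f hf)
        simp only [faces, mem_union] at a4
        rcases a4 with (a4 | a4) | a4
        · refine (pinC (a := v') (b := z) a1 (faces_sub _ _ _ _ a4) a3 ?_ ?_ ?_ ?_).elim <;>
            clear h0 h1 h2 hloc hs F0 F1 F2 A0 A1 A2 Bx By Bz fin hb k0 k1 k2 k0' k1' k2' e0 e1 e2 e0' e1' e2' hC L0 L1 L2 s0 <;> grind
        · exact a4
        · refine (pinC (a := v') (b := x) a1 (faces_sub _ _ _ _ a4) a3 ?_ ?_ ?_ ?_).elim <;>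
            clear h0 h1 h2 hloc hs F0 F1 F2 A0 A1 A2 Bx By Bz fin hb k0 k1 k2 k0' k1' k2' e0 e1 e2 e0' e1' e2' hC L0 L1 L2 s0 <;> grind
      have s2 : faces t2' x y v' ⊆ faces t2 x y v' := by
        intro f hf
        have a1 := (faces_sub _ _ _ _ hf).trans (union_subset_union_right L2)
        have a3 := faces_card k2' (bd2 hb hv) hf
        have a4 := hs (F2 f hf)
        simp only [faces, mem_union] at a4
        rcases a4 with (a4 | a4) | a4
        · refine (pinC (a := v') (b := y) a1 (faces_sub _ _ _ _ a4) a3 ?_ ?_ ?_ ?_).elim <;>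
            clear h0 h1 h2 hloc hs F0 F1 F2 A0 A1 A2 Bx By Bz fin hb k0 k1 k2 k0' k1' k2' e0 e1 e2 e0' e1' e2' hC L0 L1 L2 s0 s1 <;> grind
        · refine (pinC (a := v') (b := x) a1 (faces_sub _ _ _ _ a4) a3 ?_ ?_ ?_ ?_).elim <;>
            clear h0 h1 h2 hloc hs F0 F1 F2 A0 A1 A2 Bx By Bz fin hb k0 k1 k2 k0' k1' k2' e0 e1 e2 e0' e1' e2' hC L0 L1 L2 s0 s1 <;> grind
        · exact a4
      rw [h0 k0 k0' (bd0 hb hv) s0, h1 k1 k1' (bd1 hb hv) s1, h2 k2 k2' (bd2 hb hv) s2]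

end LT
end SCT
end

noncomputable section
namespace SCT
set_option linter.unusedSectionVars false
namespace LT
variable {V : Type} [DecidableEq V]

open CategoryTheory in
lemma good {Γ : Type} [Groupoid.{0} Γ] {ob : V → Γ} {e : ∀ x y, ob x ⟶ ob y} {K : Finset (Finset V)}
    (hinv : ∀ x y, e x y ≫ e y x = 𝟙 _) (hK : ∀ x y z, {x, y, z} ∈ K → e x y ≫ e y z = e x z)
    (t : LT V) (x y z : V) (h : faces t x y z ⊆ K) : e x y ≫ e y z = e x z := by
  induction t generalizing x y z with
  | leaf => exact hK _ _ _ (h (by simp [faces]))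
  | node v t0 t1 t2 h0 h1 h2 =>
    simp only [faces] at h
    have i0 := h0 v y z (fun f hf => h (by simp [hf]))
    have i1 := h1 x v z (fun f hf => h (by simp [hf]))
    have i2 := h2 x y v (fun f hf => h (by simp [hf]))
    rw [← i1, ← i2, ← i0, Category.assoc, ← Category.assoc (e y v), hinv, Category.id_comp]

def Phi (a c u w : V) (t : LT V) : Finset (Finset V) := insert {c, u, w} (faces t a u w)

def base (a c u w : V) : Finset V := {a, c, u, w}

lemma Phi_card3 {a c u w : V} {t : LT V} (h : ok (base a c u w) t) (hau : a ≠ u)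
    (haw : a ≠ w) (hcu : c ≠ u) (hcw : c ≠ w) (huw : u ≠ w) {f : Finset V} (hf : f ∈ Phi a c u w t) :
    f.card = 3 := by
  simp only [Phi, mem_insert] at hf
  rcases hf with rfl | hf
  · exact card_eq_three.2 ⟨c, u, w, hcu, hcw, huw, rfl⟩
  · exact faces_card h (by simp [bd, base, hau, huw, haw]) hf

lemma Phi_card {a c u w : V} {t : LT V} : (Phi a c u w t).card ≤ 2 * sz t + 2 := by
  have := card_faces t a u w
  have := card_insert_le {c, u, w} (faces t a u w)
  unfold Phi; omega

lemma Phi_ineq {A B : Finset V} (hAB : Disjoint A B) {a c : V} (hac : a ≠ c) (haA : a ∉ A) (hcA : c ∉ A)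
    (haB : a ∉ B) (hcB : c ∉ B) {u w u' w' : V} (hu : u ∈ A) (hu' : u' ∈ A) (hw : w ∈ B) (hw' : w' ∈ B)
    {t t' : LT V} (ht : ok (base a c u w) t) (ht' : ok (base a c u' w') t')
    (hne : ¬ (u = u' ∧ w = w' ∧ t = t')) (hnd : ¬ Disjoint (Phi a c u w t) (Phi a c u' w' t')) :
    2 * (ind (base a c u w ∪ labs t) u' + ind (base a c u w ∪ labs t) w' +
      nw (base a c u w ∪ labs t) t') + 1 ≤ (Phi a c u' w' t' \ Phi a c u w t).card := by
  set I := base a c u w ∪ labs t with hI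
  set X := Phi a c u w t with hXdef
  rw [Finset.disjoint_left] at hAB
  have hbd : bd (base a c u w) a u w := by
    simp only [bd, base]; refine ⟨by simp, by simp, by simp, ?_, ?_, ?_⟩ <;> rintro rfl
    · exact haA hu
    · exact hAB hu hw
    · exact haB hw
  have hbd' : bd (base a c u' w') a u' w' := by
    simp only [bd, base]; refine ⟨by simp, by simp, by simp, ?_, ?_, ?_⟩ <;> rintro rfl
    · exact haA hu'
    · exact hAB hu' hw'
    · exact haB hw'
  have hcf : ∀ f ∈ faces t a u w, c ∉ f := by
    intro f hf hc
    have h1 := faces_sub _ _ _ _ hf hc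
    simp only [mem_union, mem_insert, mem_singleton] at h1
    rcases h1 with (h1 | h1 | h1) | h1
    · exact hac h1.symm
    · exact hcA (h1 ▸ hu)
    · exact hcB (h1 ▸ hw)
    · exact ok_disj ht _ h1 (by simp [base])
  have hcf' : ∀ f ∈ faces t' a u' w', c ∉ f := by
    intro f hf hc
    have h1 := faces_sub _ _ _ _ hf hc
    simp only [mem_union, mem_insert, mem_singleton] at h1
    rcases h1 with (h1 | h1 | h1) | h1
    · exact hac h1.symm
    · exact hcA (h1 ▸ hu')
    · exact hcB (h1 ▸ hw')
    · exact ok_disj ht' _ h1 (by simp [base])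
  have hX : ∀ f ∈ X, f ⊆ I := by
    intro f hf
    simp only [hXdef, Phi, mem_insert] at hf
    rcases hf with rfl | hf
    · simp [hI, base, insert_subset_iff]
    · refine (faces_sub _ _ _ _ hf).trans (union_subset_union_left ?_)
      simp [base, insert_subset_iff]
  have hsub : (faces t' a u' w' \ X) ⊆ Phi a c u' w' t' \ X := by
    apply sdiff_subset_sdiff _ subset_rfl
    simp [Phi]
  by_cases hc : {c, u', w'} ∈ X
  · have h1 : ({c, u', w'} : Finset V) = {c, u, w} := by
      simp only [hXdef, Phi, mem_insert] at hc
      rcases hc with hc | hc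
      · exact hc
      · exact absurd (by simp) (hcf _ hc)
    have hu1 : u' = u := by
      have : u' ∈ ({c, u, w} : Finset V) := by rw [← h1]; simp
      simp only [mem_insert, mem_singleton] at this
      rcases this with h | h | h
      · exact absurd (h ▸ hu') hcA
      · exact h
      · exact absurd (h ▸ hw) (hAB hu')
    have hw1 : w' = w := by
      have : w' ∈ ({c, u, w} : Finset V) := by rw [← h1]; simp
      simp only [mem_insert, mem_singleton] at this
      rcases this with h | h | h
      · exact absurd (h ▸ hw') hcB
      · exact absurd hw' (hAB (h ▸ hu))
      · exact h
    subst hu1 hw1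
    have hi1 : ind I u' = 0 := ind_zero (by simp [hI, base])
    have hi2 : ind I w' = 0 := ind_zero (by simp [hI, base])
    rcases lemma1 hX ht' hbd' with ⟨h2, -⟩ | h2
    · exfalso
      apply hne
      refine ⟨rfl, rfl, ?_⟩
      symm
      refine uniq ht ht' hbd ?_
      intro f hf
      have := h2 hf
      simp only [hXdef, Phi, mem_insert] at this
      rcases this with rfl | h
      · exact absurd (by simp) (hcf' _ hf)
      · exact h
    · have := card_le_card hsub
      omega
  · have hex : ∃ f ∈ faces t' a u' w', f ∈ X := by
      rw [Finset.not_disjoint_iff] at hnd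
      obtain ⟨f, hf, hf'⟩ := hnd
      refine ⟨f, ?_, hf⟩
      simp only [Phi, mem_insert] at hf'
      rcases hf' with rfl | h
      · exact absurd hf hc
      · exact h
    have h2 := lemma2 hX ht' hbd' hex
    have h3 : insert {c, u', w'} (faces t' a u' w' \ X) ⊆ Phi a c u' w' t' \ X := by
      refine insert_subset ?_ hsub
      simp [Phi, hc]
    have h4 := card_le_card h3
    rw [card_insert_of_notMem] at h4
    · omega
    · intro h
      exact hcf' _ (mem_sdiff.1 h).1 (by simp)

/-! counting -/
def nodeEmb (V : Type) : V × LT V × LT V × LT V ↪ LT V :=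
  ⟨fun q => node q.1 q.2.1 q.2.2.1 q.2.2.2, by
    rintro ⟨a, b, c, d⟩ ⟨a', b', c', d'⟩ h
    simp only [node.injEq] at h
    obtain ⟨rfl, rfl, rfl, rfl⟩ := h; rfl⟩

variable [Fintype V]

def trees (V : Type) [Fintype V] : ℕ → Finset (LT V)
  | 0 => ∅
  | h + 1 => Finset.cons leaf
      ((univ ×ˢ trees V h ×ˢ trees V h ×ˢ trees V h).map (nodeEmb V)) (by simp [nodeEmb])

lemma sum_trees (h : ℕ) (f : LT V → ℝ) :
    ∑ t ∈ trees V (h+1), f t = f leaf + ∑ v, ∑ t0 ∈ trees V h, ∑ t1 ∈ trees V h, ∑ t2 ∈ trees V h,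
      f (node v t0 t1 t2) := by
  simp only [trees, sum_cons, sum_map, sum_product]
  rfl

lemma sz_trees (h : ℕ) : ∀ t ∈ trees V h, sz t ≤ 4 ^ h := by
  induction h with
  | zero => simp [trees]
  | succ h ih =>
    intro t ht
    simp only [trees, mem_cons, Finset.mem_map, mem_product, mem_univ, true_and] at ht
    rcases ht with rfl | ⟨⟨v, t0, t1, t2⟩, ⟨h0, h1, h2⟩, rfl⟩
    · simp [sz]
    · have a0 : sz t0 ≤ 4 ^ h := ih _ h0
      have a1 : sz t1 ≤ 4 ^ h := ih _ h1
      have a2 : sz t2 ≤ 4 ^ h := ih _ h2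
      change 1 + sz t0 + sz t1 + sz t2 ≤ _
      have : 1 ≤ 4 ^ h := Nat.one_le_pow _ _ (by norm_num)
      rw [pow_succ]; omega

def Rb (M : ℝ) : ℕ → ℝ
  | 0 => 0
  | h + 1 => 1 + M * Rb M h ^ 3

lemma Rb_nonneg {M : ℝ} (hM : 0 ≤ M) (h : ℕ) : 0 ≤ Rb M h := by
  induction h with
  | zero => simp [Rb]
  | succ h ih => simp only [Rb]; positivity

lemma nw_sum {p M : ℝ} (hp : 0 ≤ p) (hM : 0 ≤ M) (I : Finset V) (hI : ∑ v : V, p ^ (2 * ind I v) ≤ M) (h : ℕ) :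
    ∑ t ∈ trees V h, p ^ (2 * nw I t) ≤ Rb M h := by
  induction h with
  | zero => simp [trees, Rb]
  | succ h ih =>
    rw [sum_trees]
    simp only [nw, mul_zero, pow_zero, Rb]
    have e : ∀ v : V, ∑ t0 ∈ trees V h, ∑ t1 ∈ trees V h, ∑ t2 ∈ trees V h,
        p ^ (2 * (ind I v + nw I t0 + nw I t1 + nw I t2)) =
        p ^ (2 * ind I v) * (∑ t ∈ trees V h, p ^ (2 * nw I t)) ^ 3 := by
      intro v
      rw [pow_succ, pow_two, Finset.sum_mul_sum, Finset.sum_mul_sum, Finset.mul_sum]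
      refine sum_congr rfl fun t0 _ => ?_
      rw [Finset.mul_sum, Finset.sum_comm]
      refine sum_congr rfl fun t1 _ => ?_
      rw [Finset.sum_mul, Finset.mul_sum]
      refine sum_congr rfl fun t2 _ => ?_
      ring
    simp only [e, ← Finset.sum_mul]
    have h0 : 0 ≤ ∑ t ∈ trees V h, p ^ (2 * nw I t) := sum_nonneg fun t _ => by positivity
    gcongr

open Classical in
def okS (p : ℝ) (h : ℕ) (U : Finset V) : ℝ := ∑ t ∈ trees V h, if ok U t then p ^ (2 * sz t + 1) else 0

lemma okS_nonneg {p : ℝ} (hp : 0 ≤ p) (h : ℕ) (U : Finset V) : 0 ≤ okS p h U :=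
  sum_nonneg fun t _ => by split_ifs <;> positivity

open Classical in
lemma okS_succ {p s : ℝ} (hp : 0 ≤ p) (h : ℕ) (U : Finset V) (hs0 : 0 ≤ s)
    (hs : ∀ W : Finset V, W.card ≤ U.card + 1 + 2 * 4 ^ h → s ≤ okS p h W) :
    p + (Fintype.card V - U.card) * s ^ 3 ≤ okS p (h+1) U := by
  rw [okS, sum_trees]
  simp only [ok, if_true, sz, mul_zero, zero_add, pow_one]
  gcongr
  have e1 : ((Fintype.card V : ℝ) - U.card) * s ^ 3 = ∑ v : V, if v ∉ U then s ^ 3 else 0 := by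
    rw [← Finset.sum_filter, Finset.sum_const, nsmul_eq_mul]
    congr 1
    have : (filter (fun v => v ∉ U) univ) = Uᶜ := by ext; simp
    rw [this, card_compl, Nat.cast_sub (card_le_univ U)]
  rw [e1]
  refine sum_le_sum fun v _ => ?_
  by_cases hv : v ∉ U
  swap
  · simp [hv]
  simp only [hv, if_true, not_false_iff, true_and]
  have hc : (insert v U).card ≤ U.card + 1 := card_insert_le _ _
  calc s ^ 3 ≤ ∑ t0 ∈ trees V h, (if ok (insert v U) t0 then p ^ (2 * sz t0 + 1) else 0) * s ^ 2 := by
        rw [← Finset.sum_mul]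
        have := hs (insert v U) (by omega)
        rw [okS] at this
        nlinarith [sq_nonneg s]
    _ ≤ _ := by
        refine sum_le_sum fun t0 ht0 => ?_
        by_cases hk0 : ok (insert v U) t0
        swap
        · simp only [hk0, if_false, zero_mul, false_and]
          simp
        simp only [hk0, if_true, true_and]
        calc p ^ (2 * sz t0 + 1) * s ^ 2 ≤ ∑ t1 ∈ trees V h, p ^ (2 * sz t0 + 1) *
                ((if ok (insert v U ∪ labs t0) t1 then p ^ (2 * sz t1 + 1) else 0) * s) := by
              rw [← Finset.mul_sum, ← Finset.sum_mul]
              have := hs (insert v U ∪ labs t0) (by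
                have := card_union_le (insert v U) (labs t0)
                have := card_labs t0
                have := sz_trees h t0 ht0
                omega)
              rw [okS] at this
              gcongr
              nlinarith
          _ ≤ _ := by
              refine sum_le_sum fun t1 ht1 => ?_
              by_cases hk1 : ok (insert v U ∪ labs t0) t1
              swap
              · simp only [hk1, if_false, zero_mul, mul_zero]
                exact sum_nonneg fun t _ => by split_ifs <;> positivity
              have := hs (insert v U ∪ (labs t0 ∪ labs t1)) (by
                have := card_union_le (insert v U) (labs t0 ∪ labs t1)
                have := card_union_le (labs t0) (labs t1)
                have := card_labs t0
                have := sz_trees h t0 ht0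
                have := card_labs t1
                have := sz_trees h t1 ht1
                omega)
              rw [okS] at this
              simp only [hk1, if_true]
              calc _ ≤ p ^ (2 * sz t0 + 1) * (p ^ (2 * sz t1 + 1) * (∑ t ∈ trees V h,
                        if ok (insert v U ∪ (labs t0 ∪ labs t1)) t then p ^ (2 * sz t + 1) else 0)) := by
                      gcongr
                _ ≤ _ := by
                  rw [Finset.mul_sum, Finset.mul_sum]
                  refine sum_le_sum fun t2 _ => ?_
                  by_cases hk2 : ok (insert v U ∪ (labs t0 ∪ labs t1)) t2
                  swap
                  · simp only [hk2, if_false, mul_zero]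
                    split_ifs <;> positivity
                  obtain ⟨a1, a2⟩ := ok_union hk1
                  obtain ⟨b1, b2⟩ := ok_union hk2
                  rw [disjoint_union_left] at b2
                  simp only [hk2, if_true, a1, a2, b1, b2, and_self]
                  apply le_of_eq
                  ring

end LT
end SCT
end

noncomputable section
namespace SCT

/-! ### Janson -/
instance bern_prob (p : ℝ) : IsProbabilityMeasure (bernoulliBool p) := by
  constructor
  simp only [bernoulliBool, Measure.add_apply, Measure.smul_apply, smul_eq_mul,
    measure_univ, mul_one]
  rw [← ENNReal.ofReal_add (by simp) (by simp)]
  simp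

lemma bern_true {p : ℝ} (h0 : 0 ≤ p) (h1 : p ≤ 1) : bernoulliBool p {true} = ENNReal.ofReal p := by
  simp [bernoulliBool, h0, h1]

variable {ι : Type} [Fintype ι] [DecidableEq ι]

def PM (ι : Type) [Fintype ι] (p : ℝ) : Measure (ι → Bool) := Measure.pi fun _ => bernoulliBool p

instance (p : ℝ) : IsProbabilityMeasure (PM ι p) := by unfold PM; infer_instance

lemma meas_all (S : Set (ι → Bool)) : MeasurableSet S := S.toFinite.measurableSet

def onS (F : Finset ι) : Set (ι → Bool) := {ω | ∀ x ∈ F, ω x = true}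

lemma P_on {p : ℝ} (h0 : 0 ≤ p) (h1 : p ≤ 1) (F : Finset ι) : (PM ι p).real (onS F) = p ^ F.card := by
  have : onS F = Set.pi Set.univ (fun i => if i ∈ F then {true} else Set.univ) := by
    ext ω; simp only [onS, Set.mem_setOf_eq, Set.mem_pi, Set.mem_univ, true_implies]
    refine forall_congr' fun i => ?_
    by_cases h : i ∈ F <;> simp [h]
  rw [measureReal_def, PM, this, Measure.pi_pi]
  have : ∀ i, bernoulliBool p (if i ∈ F then {true} else Set.univ) = if i ∈ F then ENNReal.ofReal p else 1 := by
    intro i; split_ifs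
    · exact bern_true h0 h1
    · exact measure_univ
  simp only [this]
  rw [Finset.prod_ite]
  simp [h0]

lemma P_L0 {p : ℝ} (h0 : 0 ≤ p) (h1 : p ≤ 1) (F : Finset ι) (E : Set (ι → Bool)) :
    (PM ι p).real (onS F ∩ E) = p ^ F.card * (PM ι p).real {ω | (fun x => ω x || decide (x ∈ F)) ∈ E} := by
  have e1 : onS F ∩ E = onS F ∩ {ω | (fun x => ω x || decide (x ∈ F)) ∈ E} := by
    ext ω
    simp only [Set.mem_inter_iff, Set.mem_setOf_eq, onS]
    refine and_congr_right fun h => ?_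
    have : (fun x => ω x || decide (x ∈ F)) = ω := by
      funext x
      by_cases hx : x ∈ F <;> simp [hx]
      exact h x hx
    rw [this]
  have hind : ProbabilityTheory.iIndepFun (fun (i : ι) (ω : ι → Bool) => ω i) (PM ι p) :=
    ProbabilityTheory.iIndepFun_pi (X := fun _ x => x) (fun i => aemeasurable_id)
  have h2 := hind.indepFun_finset F Fᶜ disjoint_compl_right (fun i => measurable_pi_apply i)
  let G : (↥(Fᶜ) → Bool) → (ι → Bool) := fun ω x => if h : x ∈ F then true else ω ⟨x, by simpa using h⟩
  have h3 := h2.measure_inter_preimage_eq_mul {ω | ∀ x, ω x = true} {ω | G ω ∈ E}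
    (Set.toFinite _).measurableSet (Set.toFinite _).measurableSet
  have e2 : ((fun (a : ι → Bool) (i : F) => a i) ⁻¹' {ω | ∀ x, ω x = true}) = onS F := by
    ext ω; simp [onS]
  have e3 : ((fun (a : ι → Bool) (i : ↥(Fᶜ)) => a i) ⁻¹' {ω | G ω ∈ E}) =
      {ω | (fun x => ω x || decide (x ∈ F)) ∈ E} := by
    ext ω
    simp only [Set.mem_preimage, Set.mem_setOf_eq]
    have : G (fun i => ω i) = (fun x => ω x || decide (x ∈ F)) := by
      funext x
      by_cases hx : x ∈ F <;> simp [hx, G]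
    rw [this]
  rw [e2, e3] at h3
  rw [e1, measureReal_def, h3, ENNReal.toReal_mul, ← measureReal_def, ← measureReal_def, P_on h0 h1]

theorem janson {p : ℝ} (h0 : 0 ≤ p) (h1 : p ≤ 1) {κ : Type} [DecidableEq κ] (s : Finset κ) (Φ : κ → Finset ι)
    (hD : ∀ i ∈ s, ∑ j ∈ s with j ≠ i ∧ ¬ Disjoint (Φ i) (Φ j), p ^ (Φ j \ Φ i).card ≤ 1 / 2) :
    (PM ι p).real {ω | ∀ i ∈ s, ω ∉ onS (Φ i)} ≤ ∏ i ∈ s, (1 - p ^ (Φ i).card / 2) := by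
  induction s using Finset.induction_on with
  | empty => simp
  | insert i s hi ih =>
    have ih' := ih (fun k hk => by
      refine le_trans ?_ (hD k (mem_insert_of_mem hk))
      refine sum_le_sum_of_subset_of_nonneg ?_ (fun _ _ _ => by positivity)
      exact filter_subset_filter _ (subset_insert _ _))
    rw [prod_insert hi]
    set A : Set (ι → Bool) := {ω | ∀ i ∈ s, ω ∉ onS (Φ i)} with hA
    set E : Set (ι → Bool) := {ω | ∀ j ∈ s, Disjoint (Φ i) (Φ j) → ω ∉ onS (Φ j)} with hE
    set q := p ^ (Φ i).card with hq
    have hq0 : 0 ≤ q := by positivity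
    have hq1 : q ≤ 1 := pow_le_one₀ h0 h1
    have hAE : A ⊆ E := fun ω hω j hj _ => hω j hj
    have hins : {ω | ∀ k ∈ insert i s, ω ∉ onS (Φ k)} = A \ onS (Φ i) := by
      ext ω; simp [hA, and_comm]
    rw [hins]
    have hsplit := measureReal_inter_add_sdiff (μ := PM ι p) (s := A) (t := onS (Φ i)) (meas_all _)
    have hPE : (PM ι p).real (onS (Φ i) ∩ E) = q * (PM ι p).real E := by
      rw [P_L0 h0 h1]
      congr 2
      ext ω
      simp only [hE, Set.mem_setOf_eq, onS]
      refine forall_congr' fun j => forall_congr' fun hj => forall_congr' fun hd => ?_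
      refine not_congr (forall_congr' fun x => forall_congr' fun hx => ?_)
      have : x ∉ Φ i := fun h => Finset.disjoint_left.1 hd h hx
      simp [this]
    set N := s.filter (fun j => ¬ Disjoint (Φ i) (Φ j)) with hN
    have hB : ∀ j ∈ N, (PM ι p).real (onS (Φ i ∪ Φ j) ∩ E) ≤ q * p ^ (Φ j \ Φ i).card * (PM ι p).real E := by
      intro j hj
      rw [P_L0 h0 h1, hq, ← pow_add, ← card_union_of_disjoint disjoint_sdiff, union_sdiff_self_eq_union]
      refine mul_le_mul_of_nonneg_left (measureReal_mono ?_) (by positivity)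
      intro ω hω j hj hd hon
      exact hω j hj hd (fun x hx => by simp [hon x hx])
    have hsub : onS (Φ i) ∩ E ⊆ (A ∩ onS (Φ i)) ∪ ⋃ j ∈ N, (onS (Φ i ∪ Φ j) ∩ E) := by
      rintro ω ⟨h1, h2⟩
      by_cases hω : ω ∈ A
      · exact Or.inl ⟨hω, h1⟩
      · right
        simp only [hA, Set.mem_setOf_eq, not_forall, not_not] at hω
        obtain ⟨j, hj, hω⟩ := hω
        refine Set.mem_biUnion (x := j) ?_ ⟨?_, h2⟩
        · simp only [hN, coe_filter, Set.mem_setOf_eq]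
          exact ⟨hj, fun hd => h2 j hj hd hω⟩
        · intro x hx
          rcases mem_union.1 hx with hx | hx
          · exact h1 x hx
          · exact hω x hx
    have hDi : ∑ j ∈ N, p ^ (Φ j \ Φ i).card ≤ 1 / 2 := by
      refine le_trans ?_ (hD i (mem_insert_self _ _))
      refine sum_le_sum_of_subset_of_nonneg ?_ (fun _ _ _ => by positivity)
      intro j hj
      simp only [hN, mem_filter] at hj
      simp only [mem_filter, mem_insert]
      exact ⟨Or.inr hj.1, fun h => hi (h ▸ hj.1), hj.2⟩
    have k1 : (PM ι p).real (onS (Φ i) ∩ E) ≤ (PM ι p).real (A ∩ onS (Φ i)) +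
        ∑ j ∈ N, (PM ι p).real (onS (Φ i ∪ Φ j) ∩ E) := by
      refine (measureReal_mono hsub).trans ((measureReal_union_le _ _).trans ?_)
      gcongr
      exact measureReal_biUnion_finset_le _ _
    have k2 : ∑ j ∈ N, (PM ι p).real (onS (Φ i ∪ Φ j) ∩ E) ≤ q * (1/2) * (PM ι p).real E := by
      refine (sum_le_sum hB).trans ?_
      rw [← Finset.sum_mul, ← Finset.mul_sum]
      gcongr
    have k3 : (PM ι p).real A ≤ (PM ι p).real E := measureReal_mono hAE
    have k4 : 0 ≤ 1 - q / 2 := by linarith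
    calc (PM ι p).real (A \ onS (Φ i)) ≤ (1 - q / 2) * (PM ι p).real A := by nlinarith
      _ ≤ _ := by gcongr

theorem janson_exp {p : ℝ} (h0 : 0 ≤ p) (h1 : p ≤ 1) {κ : Type} [DecidableEq κ] (s : Finset κ) (Φ : κ → Finset ι)
    (hD : ∀ i ∈ s, ∑ j ∈ s with j ≠ i ∧ ¬ Disjoint (Φ i) (Φ j), p ^ (Φ j \ Φ i).card ≤ 1 / 2) :
    (PM ι p).real {ω | ∀ i ∈ s, ω ∉ onS (Φ i)} ≤ Real.exp (- (∑ i ∈ s, p ^ (Φ i).card) / 2) := by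
  refine (janson h0 h1 s Φ hD).trans ?_
  rw [neg_div, Finset.sum_div, ← Finset.sum_neg_distrib, Real.exp_sum]
  refine prod_le_prod (fun i _ => ?_) (fun i _ => ?_)
  · have : p ^ (Φ i).card ≤ 1 := pow_le_one₀ h0 h1
    linarith
  · have := Real.add_one_le_exp (-(p ^ (Φ i).card / 2))
    linarith

end SCT
end

noncomputable section
namespace SCT
set_option linter.unusedSectionVars false
namespace LT

lemma okS_lb {V : Type} [DecidableEq V] [Fintype V] {p r : ℝ} (hr : 0 < r) (hr2 : r ^ 2 = Fintype.card V)
    (hp : p = 0.49 / r) (h : ℕ) : ∀ U : Finset V, 10 * (U.card + 4 ^ h) ≤ Fintype.card V →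
    0.05 * h / r ≤ okS p h U := by
  have hp0 : 0 ≤ p := by rw [hp]; positivity
  induction h with
  | zero => intro U _; simpa using okS_nonneg hp0 0 U
  | succ h ih =>
    intro U hU
    have h1 : 1 ≤ 4 ^ h := Nat.one_le_pow _ _ (by norm_num)
    rw [pow_succ] at hU
    refine le_trans ?_ (okS_succ hp0 h U (s := 0.05 * h / r) (by positivity) (fun W hW => ih W (by omega)))
    have hc : (10 : ℝ) * U.card ≤ Fintype.card V := by exact_mod_cast (by omega : 10 * U.card ≤ Fintype.card V)
    set s : ℝ := 0.05 * h with hs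
    have hs0 : 0 ≤ s := by positivity
    have key : s + 0.05 ≤ 0.49 + 0.9 * s ^ 3 := by
      nlinarith [mul_nonneg hs0 (sq_nonneg (s - 0.6)), sq_nonneg (s - 0.6)]
    have e : (0.49 + 0.9 * s ^ 3) / r = p + (0.9 * r ^ 2) * (s / r) ^ 3 := by
      rw [hp]; field_simp
    calc 0.05 * ((h + 1 : ℕ) : ℝ) / r = (s + 0.05) / r := by push_cast; rw [hs]; ring
      _ ≤ (0.49 + 0.9 * s ^ 3) / r := by gcongr
      _ = p + (0.9 * r ^ 2) * (s / r) ^ 3 := e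
      _ ≤ _ := by
        rw [hr2]
        have : 0 ≤ (s / r) ^ 3 := by positivity
        gcongr
        linarith

lemma ind_sum {V : Type} [DecidableEq V] [Fintype V] {p : ℝ} (hp2 : Fintype.card V * p ^ 2 ≤ 1)
    (I : Finset V) : ∑ v : V, p ^ (2 * ind I v) ≤ I.card + 1 := by
  have : ∀ v, p ^ (2 * ind I v) ≤ (if v ∈ I then 1 else 0) + p ^ 2 := by
    intro v
    unfold ind
    split_ifs
    · simpa using sq_nonneg p
    · simp
  refine (sum_le_sum fun v _ => this v).trans ?_
  rw [sum_add_distrib]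
  simp
  exact hp2

end LT
open SCT.LT

def isOn {n : ℕ} (ω : FaceIdx n 2 → Bool) (F : Finset (Finset (Fin n))) : Prop :=
  ∀ f ∈ F, ∃ h : f.card = 2 + 1, ω ⟨f, h⟩ = true

def badE {n : ℕ} (a c : Fin n) (A B : Finset (Fin n)) : Set (FaceIdx n 2 → Bool) :=
  {ω | ∀ u ∈ A, ∀ w ∈ B, ∀ t : LT (Fin n), ¬ isOn ω (Phi a c u w t)}

def sub3 {n : ℕ} (F : Finset (Finset (Fin n))) : Finset (FaceIdx n 2) := F.subtype (fun f => f.card = 2 + 1)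

lemma sub3_card {n : ℕ} {F : Finset (Finset (Fin n))} (hF : ∀ f ∈ F, f.card = 3) : (sub3 F).card = F.card := by
  rw [sub3, Finset.card_subtype, filter_true_of_mem hF]

lemma sub3_on {n : ℕ} {F : Finset (Finset (Fin n))} (hF : ∀ f ∈ F, f.card = 3) {ω : FaceIdx n 2 → Bool}
    (h : ω ∈ onS (sub3 F)) : isOn ω F := fun f hf => ⟨hF f hf, h _ (by simp [sub3, hf])⟩

open Classical in
theorem jan {n : ℕ} {p r : ℝ} (hr : 0 < r) (hr2 : r ^ 2 = n) (hp : p = 0.49 / r) (hp1 : p ≤ 1) (h : ℕ)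
    (c1 : 10 * (4 + 4 ^ h) ≤ n) {M : ℝ} (hM : M = (4 + 4 ^ h : ℕ) + 1) (c2 : p * (M ^ 2 * Rb M h) ≤ 1 / 2)
    {A B : Finset (Fin n)} (hAB : Disjoint A B) {a c : Fin n} (hac : a ≠ c) (haA : a ∉ A) (hcA : c ∉ A)
    (haB : a ∉ B) (hcB : c ∉ B) :
    (PM (FaceIdx n 2) p).real (badE a c A B) ≤
      Real.exp (-((A.card * B.card : ℝ) * (p * (0.05 * h / r))) / 2) := by
  have hp0 : 0 ≤ p := by rw [hp]; positivity
  set s : Finset (Fin n × Fin n × LT (Fin n)) :=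
    (A ×ˢ B ×ˢ trees (Fin n) h).filter (fun q => ok (base a c q.1 q.2.1) q.2.2) with hs
  set Φ : Fin n × Fin n × LT (Fin n) → Finset (FaceIdx n 2) :=
    fun q => sub3 (Phi a c q.1 q.2.1 q.2.2) with hΦ
  have mem : ∀ q, q ∈ s ↔ (q.1 ∈ A ∧ q.2.1 ∈ B ∧ q.2.2 ∈ trees (Fin n) h) ∧ ok (base a c q.1 q.2.1) q.2.2 := by
    intro q; simp [hs]
  have c3 : ∀ q ∈ s, ∀ f ∈ Phi a c q.1 q.2.1 q.2.2, f.card = 3 := by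
    intro q hq f hf
    obtain ⟨⟨hu, hw, -⟩, ho⟩ := (mem q).1 hq
    refine Phi_card3 ho ?_ ?_ ?_ ?_ ?_ hf
    · rintro e; exact haA (e ▸ hu)
    · rintro e; exact haB (e ▸ hw)
    · rintro e; exact hcA (e ▸ hu)
    · rintro e; exact hcB (e ▸ hw)
    · rintro e; exact Finset.disjoint_left.1 hAB hu (e ▸ hw)
  have hM0 : 0 ≤ M := by rw [hM]; positivity
  have hsub : badE a c A B ⊆ {ω | ∀ i ∈ s, ω ∉ onS (Φ i)} := by
    intro ω hω q hq hon
    obtain ⟨⟨hu, hw, -⟩, ho⟩ := (mem q).1 hq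
    exact hω q.1 hu q.2.1 hw q.2.2 (sub3_on (c3 q hq) hon)
  refine (measureReal_mono hsub).trans ((janson_exp hp0 hp1 s Φ ?_).trans ?_)
  · intro i hi
    obtain ⟨⟨hu, hw, htr⟩, ho⟩ := (mem i).1 hi
    set I := base a c i.1 i.2.1 ∪ labs i.2.2 with hI
    have hIc : I.card ≤ 4 + 4 ^ h := by
      have h1 := card_union_le (base a c i.1 i.2.1) (labs i.2.2)
      rw [← hI] at h1
      have h2 : (base a c i.1 i.2.1).card ≤ 4 := Finset.card_le_four
      have h3 := card_labs i.2.2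
      have h4 := sz_trees h _ htr
      omega
    have hIs : ∑ v, p ^ (2 * ind I v) ≤ M := by
      refine (ind_sum (p := p) ?_ I).trans ?_
      · rw [Fintype.card_fin, ← hr2, hp, div_pow, mul_div_cancel₀ _ (by positivity)]; norm_num
      · rw [hM]; gcongr
    have hnw := nw_sum hp0 hM0 I hIs h
    calc ∑ j ∈ s with j ≠ i ∧ ¬ Disjoint (Φ i) (Φ j), p ^ (Φ j \ Φ i).card
        ≤ ∑ j ∈ s with j ≠ i ∧ ¬ Disjoint (Φ i) (Φ j),
            p * (p ^ (2 * ind I j.1) * (p ^ (2 * ind I j.2.1) * p ^ (2 * nw I j.2.2))) := by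
          refine sum_le_sum fun j hj => ?_
          rw [mem_filter] at hj
          obtain ⟨hj, hne, hnd⟩ := hj
          obtain ⟨⟨hu', hw', htr'⟩, ho'⟩ := (mem j).1 hj
          have e : Φ j \ Φ i = sub3 (Phi a c j.1 j.2.1 j.2.2 \ Phi a c i.1 i.2.1 i.2.2) := by
            ext f; simp [hΦ, sub3]
          rw [e, sub3_card (fun f hf => c3 j hj f (mem_sdiff.1 hf).1)]
          have := Phi_ineq hAB hac haA hcA haB hcB hu hu' hw hw' ho ho' (by
            rintro ⟨e1, e2, e3⟩
            exact hne (Prod.ext e1.symm (Prod.ext e2.symm e3.symm))) (by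
            intro hd
            refine hnd (Finset.disjoint_left.2 fun f hf hf' => ?_)
            simp only [hΦ, sub3, mem_subtype] at hf hf'
            exact Finset.disjoint_left.1 hd hf hf')
          refine (pow_le_pow_of_le_one hp0 hp1 this).trans (le_of_eq ?_)
          rw [← hI]; ring
      _ ≤ ∑ j ∈ univ ×ˢ univ ×ˢ trees (Fin n) h,
            p * (p ^ (2 * ind I j.1) * (p ^ (2 * ind I j.2.1) * p ^ (2 * nw I j.2.2))) := by
          refine sum_le_sum_of_subset_of_nonneg ?_ (fun _ _ _ => by positivity)
          intro j hj
          have := ((mem j).1 (mem_filter.1 hj).1).1.2.2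
          simp [this]
      _ = p * ((∑ v, p ^ (2 * ind I v)) * ((∑ v, p ^ (2 * ind I v)) * ∑ t ∈ trees (Fin n) h, p ^ (2 * nw I t))) := by
          rw [← Finset.mul_sum, sum_product]
          simp only [sum_product]
          simp only [← Finset.mul_sum, ← Finset.sum_mul]
      _ ≤ p * (M * (M * Rb M h)) := by
          have : 0 ≤ ∑ t ∈ trees (Fin n) h, p ^ (2 * nw I t) := sum_nonneg fun _ _ => by positivity
          have : 0 ≤ ∑ v, p ^ (2 * ind I v) := sum_nonneg fun _ _ => by positivity
          gcongr
      _ ≤ 1 / 2 := by rw [← mul_assoc M, ← pow_two]; exact c2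
  · apply Real.exp_le_exp.2
    rw [neg_div, neg_div]
    apply neg_le_neg
    gcongr
    have e : (A.card * B.card : ℝ) * (p * (0.05 * h / r)) = ∑ u ∈ A, ∑ w ∈ B, p * (0.05 * h / r) := by
      simp; ring
    rw [e]
    calc _ ≤ ∑ u ∈ A, ∑ w ∈ B, p * okS p h (base a c u w) := by
          refine sum_le_sum fun u _ => sum_le_sum fun w _ => ?_
          refine mul_le_mul_of_nonneg_left ?_ hp0
          refine okS_lb hr (by simpa using hr2) hp h _ ?_
          have h2 : (base a c u w).card ≤ 4 := Finset.card_le_four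
          rw [Fintype.card_fin]; omega
      _ = ∑ q ∈ s, p ^ (2 * sz q.2.2 + 2) := by
          rw [hs, sum_filter, sum_product]
          refine sum_congr rfl fun u _ => ?_
          rw [sum_product]
          refine sum_congr rfl fun w _ => ?_
          rw [okS, Finset.mul_sum]
          refine sum_congr rfl fun t _ => ?_
          split_ifs <;> ring
      _ ≤ _ := by
          refine sum_le_sum fun q hq => ?_
          refine pow_le_pow_of_le_one hp0 hp1 ?_
          rw [hΦ]
          simp only
          rw [sub3_card (c3 q hq)]
          exact Phi_card

end SCT
end

noncomputable section
namespace SCT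
set_option linter.unusedSectionVars false
open SCT.LT

lemma big_class {V : Type} [Fintype V] [DecidableEq V] {n : ℕ} (W : Finset V) (hn : 20 ≤ n) (hW : n ≤ W.card + 2)
    (S : Setoid V)
    (hS : ∀ A B : Finset V, A ⊆ W → B ⊆ W → Disjoint A B → n ≤ 5 * A.card → n ≤ 5 * B.card →
      ∃ u ∈ A, ∃ w ∈ B, S u w) :
    ∃ C : Finset V, C ⊆ W ∧ 5 * (W \ C).card < n ∧ ∀ u ∈ C, ∀ w ∈ C, S u w := by
  classical
  set F := W.powerset.filter (fun A => 5 * A.card < n ∧ ∀ x ∈ A, ∀ y ∈ W, S x y → y ∈ A) with hF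
  have hne : F.Nonempty := ⟨∅, by simp [hF]; omega⟩
  obtain ⟨A, hA, hmax⟩ := F.exists_max_image Finset.card hne
  simp only [hF, mem_filter, mem_powerset] at hA hmax
  obtain ⟨hAW, hAc, hAs⟩ := hA
  have : ∃ x ∈ W, x ∉ A := by
    by_contra hcon
    push Not at hcon
    have := card_le_card (show W ⊆ A from hcon)
    omega
  obtain ⟨x, hxW, hxA⟩ := this
  set C := W.filter (fun y => S x y) with hC
  have hxC : x ∈ C := by simp [hC, hxW]
  have hCW : C ⊆ W := filter_subset _ _
  have hCs : ∀ u ∈ C, ∀ y ∈ W, S u y → y ∈ C := by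
    intro u hu y hy huy
    simp only [hC, mem_filter] at hu ⊢
    exact ⟨hy, S.trans hu.2 huy⟩
  have hD : Disjoint A C := by
    rw [Finset.disjoint_left]
    intro u hu hu'
    simp only [hC, mem_filter] at hu'
    exact hxA (hAs u hu x hxW (S.symm hu'.2))
  have hUc : (A ∪ C).card = A.card + C.card := card_union_of_disjoint hD
  have hUs : ∀ u ∈ A ∪ C, ∀ y ∈ W, S u y → y ∈ A ∪ C := by
    intro u hu y hy huy
    rcases mem_union.1 hu with hu | hu
    · exact mem_union_left _ (hAs u hu y hy huy)
    · exact mem_union_right _ (hCs u hu y hy huy)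
  have hUW : A ∪ C ⊆ W := union_subset hAW hCW
  have hC0 : 0 < C.card := card_pos.2 ⟨x, hxC⟩
  have hbig : n ≤ 5 * (A ∪ C).card := by
    by_contra hlt
    have := hmax (A ∪ C) ⟨hUW, by omega, hUs⟩
    omega
  have hcut : ∀ X : Finset V, X ⊆ W → (∀ u ∈ X, ∀ y ∈ W, S u y → y ∈ X) → n ≤ 5 * X.card →
      5 * (W \ X).card < n := by
    intro X hX hXs hXc
    by_contra hlt
    obtain ⟨u, hu, w, hw, huw⟩ := hS X (W \ X) hX sdiff_subset disjoint_sdiff hXc (by omega)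
    rw [Finset.mem_sdiff] at hw
    exact hw.2 (hXs u hu w hw.1 huw)
  have h1 := hcut _ hUW hUs hbig
  have h2 : (W \ (A ∪ C)).card + (A ∪ C).card = W.card := card_sdiff_add_card_eq_card hUW
  refine ⟨C, hCW, hcut C hCW hCs (by omega), ?_⟩
  intro u hu w hw
  simp only [hC, mem_filter] at hu hw
  exact S.trans (S.symm hu.2) hw.2

def Rel {n : ℕ} (ω : FaceIdx n 2 → Bool) (a c u w : Fin n) : Prop := ∃ t : LT (Fin n), isOn ω (Phi a c u w t)

def Qp (n : ℕ) (ω : FaceIdx n 2 → Bool) : Prop :=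
  ∀ a c : Fin n, a ≠ c → ∀ A B : Finset (Fin n), Disjoint A B → a ∉ A → c ∉ A → a ∉ B → c ∉ B →
    n ≤ 5 * A.card → n ≤ 5 * B.card → ω ∉ badE a c A B

lemma Q_class {n : ℕ} (hn : 20 ≤ n) {ω : FaceIdx n 2 → Bool} (hQ : Qp n ω) (a c : Fin n) (hac : a ≠ c) :
    ∃ C : Finset (Fin n), a ∉ C ∧ c ∉ C ∧ 4 * n ≤ 5 * (C.card + 2) ∧
      ∀ u ∈ C, ∀ w ∈ C, Relation.EqvGen (Rel ω a c) u w := by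
  have hW : ((univ : Finset (Fin n)) \ {a, c}).card + 2 = n := by
    rw [← card_pair hac, card_sdiff_add_card_eq_card (subset_univ _)]; simp
  obtain ⟨C, hCW, hC, hS⟩ := big_class (univ \ {a, c}) hn (by omega) (Relation.EqvGen.setoid (Rel ω a c)) (by
    intro A B hA hB hAB hAc hBc
    have hA' : ∀ x ∈ A, x ≠ a ∧ x ≠ c := fun x hx => by simpa using hA hx
    have hB' : ∀ x ∈ B, x ≠ a ∧ x ≠ c := fun x hx => by simpa using hB hx
    have := hQ a c hac A B hAB (fun h => (hA' _ h).1 rfl) (fun h => (hA' _ h).2 rfl)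
      (fun h => (hB' _ h).1 rfl) (fun h => (hB' _ h).2 rfl) hAc hBc
    simp only [badE, Set.mem_ofPred_eq] at this
    push Not at this
    obtain ⟨u, hu, w, hw, t, ht⟩ := this
    exact ⟨u, hu, w, hw, Relation.EqvGen.rel _ _ ⟨t, ht⟩⟩)
  refine ⟨C, fun h => by simpa using hCW h, fun h => by simpa using hCW h, ?_, hS⟩
  have := card_sdiff_add_card_eq_card hCW
  omega

def orF {ι : Type} (ω1 ω2 : ι → Bool) : ι → Bool := fun i => ω1 i || ω2 i

open CategoryTheory in
theorem det {n : ℕ} (hn : 20 ≤ n) {ω1 ω2 : FaceIdx n 2 → Bool} (C : Fin n → Fin n → Finset (Fin n))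
    (hC : ∀ a c, a ≠ c → 4 * n ≤ 5 * ((C a c).card + 2))
    (hR : ∀ a c, a ≠ c → ∀ u ∈ C a c, ∀ w ∈ C a c, Relation.EqvGen (Rel ω1 a c) u w)
    (h2 : ∀ a c, a ≠ c → ∃ d ∈ C a c, ∃ h : ({a, c, d} : Finset (Fin n)).card = 2 + 1, ω2 ⟨_, h⟩ = true) :
    SimplyConnectedSpace (geomReal n (Ycomplex n 2 (orF ω1 ω2))) := by
  have hK2 : ∀ s : Finset (Fin n), s.card ≤ 2 → s ∈ Ycomplex n 2 (orF ω1 ω2) := by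
    intro s hs; simp [Ycomplex, hs]
  refine simplyConnected_of (by omega) hK2 ?_
  intro Γ _ ob e hinv hK
  have hon : ∀ F : Finset (Finset (Fin n)), isOn ω1 F → F ⊆ Ycomplex n 2 (orF ω1 ω2) := by
    intro F hF f hf
    obtain ⟨h, h'⟩ := hF f hf
    simp only [Ycomplex, mem_filter, mem_univ, true_and]
    exact Or.inr ⟨h, by simp [orF, h']⟩
  have hrel : ∀ a c u w, Rel ω1 a c u w → e a u ≫ e u c = e a w ≫ e w c := by
    rintro a c u w ⟨t, ht⟩
    have h1 := hon _ ht
    have i1 := good hinv hK t a u w (fun f hf => h1 (by simp [Phi, hf]))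
    have i2 := hK u w c (h1 (by
      have : ({u, w, c} : Finset (Fin n)) = {c, u, w} := by ext; simp; tauto
      simp [Phi, this]))
    rw [← i1, ← i2, Category.assoc]
  have heq : ∀ a c u w, Relation.EqvGen (Rel ω1 a c) u w → e a u ≫ e u c = e a w ≫ e w c := by
    intro a c u w h
    induction h with
    | rel _ _ h => exact hrel _ _ _ _ h
    | refl => rfl
    | symm _ _ _ ih => exact ih.symm
    | trans _ _ _ _ _ i1 i2 => exact i1.trans i2
  have hmain : ∀ a c, a ≠ c → ∀ b ∈ C a c, e a b ≫ e b c = e a c := by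
    intro a c hac b hb
    obtain ⟨d, hd, h, hω⟩ := h2 a c hac
    rw [heq a c b d (hR a c hac b hb d hd)]
    apply hK
    have : ({a, d, c} : Finset (Fin n)) = {a, c, d} := by ext; simp; tauto
    rw [this]
    simp only [Ycomplex, mem_filter, mem_univ, true_and]
    exact Or.inr ⟨h, by simp [orF, hω]⟩
  intro x y z
  by_cases hxy : x = y
  · exact hK _ _ _ (hK2 _ (by subst hxy; simpa using card_le_two))
  by_cases hyz : y = z
  · exact hK _ _ _ (hK2 _ (by subst hyz; simpa using card_le_two))
  by_cases hxz : x = z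
  · refine hK _ _ _ (hK2 _ ?_)
    subst hxz
    have : ({x, y, x} : Finset (Fin n)) = {x, y} := by ext; simp; tauto
    rw [this]; exact card_le_two
  have hv : ∃ v, v ∈ C x y ∧ v ∈ C y z ∧ v ∈ C x z := by
    by_contra hcon
    push Not at hcon
    have hu : (univ : Finset (Fin n)) ⊆ (C x y)ᶜ ∪ ((C y z)ᶜ ∪ (C x z)ᶜ) := by
      intro v _
      simp only [mem_union, mem_compl]
      have := hcon v
      tauto
    have k1 := card_le_card hu
    have k2 := card_union_le (C x y)ᶜ ((C y z)ᶜ ∪ (C x z)ᶜ)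
    have k3 := card_union_le (C y z)ᶜ (C x z)ᶜ
    have j1 := hC x y hxy
    have j2 := hC y z hyz
    have j3 := hC x z hxz
    simp only [card_univ, card_compl, Fintype.card_fin] at k1 k2 k3
    omega
  obtain ⟨v, v1, v2, v3⟩ := hv
  rw [← hmain x y hxy v v1, ← hmain y z hyz v v2, ← hmain x z hxz v v3, Category.assoc,
    ← Category.assoc (e v y), hinv, Category.id_comp]

end SCT
end

noncomputable section
namespace SCT
set_option linter.unusedSectionVars false
open SCT.LT

lemma bool_ext {μ ν : Measure Bool} [IsProbabilityMeasure μ] [IsProbabilityMeasure ν]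
    (h : μ {false} = ν {false}) : μ = ν := by
  have e : ({false}ᶜ : Set Bool) = {true} := by ext b; cases b <;> simp
  have h' : μ {true} = ν {true} := by
    rw [← e, prob_compl_eq_one_sub (by simp), prob_compl_eq_one_sub (by simp), h]
  refine Measure.ext_of_singleton fun b => ?_
  cases b
  · exact h
  · exact h'

lemma bern_false (p : ℝ) : bernoulliBool p {false} = ENNReal.ofReal (1 - max 0 (min p 1)) := by
  simp [bernoulliBool]

lemma bern_or {p p1 p2 : ℝ} (h1 : 0 ≤ p1) (h1' : p1 ≤ 1) (h2 : 0 ≤ p2) (h2' : p2 ≤ 1)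
    (h : max 0 (min p 1) = 1 - (1 - p1) * (1 - p2)) :
    ((bernoulliBool p1).prod (bernoulliBool p2)).map (fun x => x.1 || x.2) = bernoulliBool p := by
  have hm : Measurable (fun x : Bool × Bool => x.1 || x.2) := measurable_of_finite _
  have : IsProbabilityMeasure (((bernoulliBool p1).prod (bernoulliBool p2)).map (fun x => x.1 || x.2)) :=
    Measure.isProbabilityMeasure_map hm.aemeasurable
  apply bool_ext
  rw [Measure.map_apply hm (by simp)]
  have e : (fun x : Bool × Bool => x.1 || x.2) ⁻¹' {false} = {false} ×ˢ {false} := by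
    ext ⟨a, b⟩; simp
  rw [e, Measure.prod_prod, bern_false, bern_false, bern_false, h, ← ENNReal.ofReal_mul]
  · simp [h1, h1', h2, h2']
  · simp [h1, h1']

lemma PM_or {ι : Type} [Fintype ι] {p p1 p2 : ℝ} (h1 : 0 ≤ p1) (h1' : p1 ≤ 1) (h2 : 0 ≤ p2) (h2' : p2 ≤ 1)
    (h : max 0 (min p 1) = 1 - (1 - p1) * (1 - p2)) :
    PM ι p = ((PM ι p1).prod (PM ι p2)).map (fun x => orF x.1 x.2) := by
  have hm : Measurable (fun x : Bool × Bool => x.1 || x.2) := measurable_of_finite _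
  have hm2 : Measurable (fun x : (ι → Bool) × (ι → Bool) => orF x.1 x.2) := measurable_of_finite _
  have hp := measurePreserving_arrowProdEquivProdArrow Bool Bool ι (fun _ => bernoulliBool p1)
    (fun _ => bernoulliBool p2)
  unfold PM
  rw [← hp.map_eq, Measure.map_map hm2 hp.measurable]
  have e : ((fun x : (ι → Bool) × (ι → Bool) => orF x.1 x.2) ∘ (MeasurableEquiv.arrowProdEquivProdArrow Bool Bool ι))
      = fun f i => (fun x : Bool × Bool => x.1 || x.2) (f i) := by
    funext f i; rfl
  rw [e, Measure.pi_map_pi (fun _ => hm.aemeasurable)]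
  simp only [bern_or h1 h1' h2 h2' h]

lemma Q_prob {n : ℕ} {p r : ℝ} (hr : 0 < r) (hr2 : r ^ 2 = n) (hp : p = 0.49 / r) (hp1 : p ≤ 1) (h : ℕ)
    (hh : h = 10000)
    (c1 : 10 * (4 + 4 ^ h) ≤ n) {M : ℝ} (hM : M = (4 + 4 ^ h : ℕ) + 1) (c2 : p * (M ^ 2 * Rb M h) ≤ 1 / 2) :
    (PM (FaceIdx n 2) p).real {ω | ¬ Qp n ω} ≤ n ^ 2 * Real.exp (-n) := by
  classical
  set T : Finset (Fin n × Fin n × Finset (Fin n) × Finset (Fin n)) := univ.filter (fun q =>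
    q.1 ≠ q.2.1 ∧ Disjoint q.2.2.1 q.2.2.2 ∧ q.1 ∉ q.2.2.1 ∧ q.2.1 ∉ q.2.2.1 ∧ q.1 ∉ q.2.2.2 ∧ q.2.1 ∉ q.2.2.2 ∧
    n ≤ 5 * q.2.2.1.card ∧ n ≤ 5 * q.2.2.2.card) with hT
  have hsub : {ω | ¬ Qp n ω} ⊆ ⋃ q ∈ T, badE q.1 q.2.1 q.2.2.1 q.2.2.2 := by
    intro ω hω
    simp only [Qp, Set.mem_ofPred_eq] at hω
    push Not at hω
    obtain ⟨a, c, hac, A, B, hAB, k1, k2, k3, k4, k5, k6, hbad⟩ := hω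
    refine Set.mem_biUnion (x := (a, c, A, B)) ?_ hbad
    simp only [hT, coe_filter, mem_univ, true_and, Set.mem_ofPred_eq]
    exact ⟨hac, hAB, k1, k2, k3, k4, k5, k6⟩
  have hb : ∀ q ∈ T, (PM (FaceIdx n 2) p).real (badE q.1 q.2.1 q.2.2.1 q.2.2.2) ≤ Real.exp (-(4.9 * n)) := by
    rintro ⟨a, c, A, B⟩ hq
    simp only [hT, mem_filter, mem_univ, true_and] at hq
    obtain ⟨hac, hAB, k1, k2, k3, k4, k5, k6⟩ := hq
    refine (jan hr hr2 hp hp1 h c1 hM c2 hAB hac k1 k2 k3 k4).trans (Real.exp_le_exp.2 ?_)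
    have e5 : (n : ℝ) ≤ 5 * A.card := by exact_mod_cast k5
    have e6 : (n : ℝ) ≤ 5 * B.card := by exact_mod_cast k6
    have e7 : p * (0.05 * h / r) = 245 / n := by
      rw [hp, ← hr2, hh]; push_cast; field_simp; norm_num
    have hn0 : (0 : ℝ) < n := by rw [← hr2]; positivity
    rw [e7]
    have : (n / 5 : ℝ) * (n / 5) ≤ A.card * B.card := by gcongr <;> linarith
    have : (n / 5 : ℝ) * (n / 5) * (245 / n) ≤ A.card * B.card * (245 / n) := by gcongr
    have e : (n / 5 : ℝ) * (n / 5) * (245 / n) = 9.8 * n := by field_simp; norm_num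
    linarith
  have hcard : (T.card : ℝ) ≤ n ^ 2 * 4 ^ n := by
    have h1 : T.card ≤ n * (n * (2 ^ n * 2 ^ n)) := by
      refine (card_le_univ T).trans (le_of_eq ?_)
      simp
    have h2 : (T.card : ℝ) ≤ n * (n * (2 ^ n * 2 ^ n)) := by exact_mod_cast h1
    refine h2.trans (le_of_eq ?_)
    rw [← mul_pow]; norm_num; ring
  have h4 : (4 : ℝ) ^ n ≤ Real.exp (2 * n) := by
    have : (4 : ℝ) ≤ Real.exp 2 := by
      have := Real.exp_one_gt_d9
      have e : Real.exp 2 = Real.exp 1 * Real.exp 1 := by rw [← Real.exp_add]; norm_num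
      rw [e]; nlinarith
    calc (4 : ℝ) ^ n ≤ Real.exp 2 ^ n := by gcongr
      _ = _ := by rw [← Real.exp_nat_mul]; ring_nf
  calc _ ≤ ∑ q ∈ T, (PM (FaceIdx n 2) p).real (badE q.1 q.2.1 q.2.2.1 q.2.2.2) :=
        (measureReal_mono hsub (measure_ne_top _ _)).trans (measureReal_biUnion_finset_le _ _)
    _ ≤ T.card • Real.exp (-(4.9 * n)) := sum_le_card_nsmul _ _ _ hb
    _ ≤ (n ^ 2 * 4 ^ n) * Real.exp (-(4.9 * n)) := by rw [nsmul_eq_mul]; gcongr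
    _ ≤ (n ^ 2 * Real.exp (2 * n)) * Real.exp (-(4.9 * n)) := by gcongr
    _ = n ^ 2 * Real.exp (2 * n + -(4.9 * n)) := by rw [Real.exp_add]; ring
    _ ≤ _ := by
      gcongr
      have : (0 : ℝ) ≤ n := by positivity
      linarith

lemma G_prob {n : ℕ} (hn : 20 ≤ n) {p r : ℝ} (hr : 0 < r) (hr2 : r ^ 2 = n) (hp1 : p ≤ 1) (hp : 0.01 / r ≤ p)
    (C : Fin n → Fin n → Finset (Fin n))
    (hC : ∀ a c, a ≠ c → a ∉ C a c ∧ c ∉ C a c ∧ 4 * n ≤ 5 * ((C a c).card + 2)) :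
    (PM (FaceIdx n 2) p).real {ω | ¬ ∀ a c, a ≠ c → ∃ d ∈ C a c,
      ∃ h : ({a, c, d} : Finset (Fin n)).card = 2 + 1, ω ⟨_, h⟩ = true} ≤ n ^ 2 * Real.exp (-(0.0025 * r)) := by
  classical
  have hp0 : 0 ≤ p := le_trans (by positivity) hp
  set T : Finset (Fin n × Fin n) := univ.filter (fun q => q.1 ≠ q.2) with hT
  set Φ : Fin n × Fin n → Fin n → Finset (FaceIdx n 2) := fun q d => sub3 {{q.1, q.2, d}} with hΦ
  have c3 : ∀ q ∈ T, ∀ d ∈ C q.1 q.2, ∀ f ∈ ({{q.1, q.2, d}} : Finset (Finset (Fin n))), f.card = 3 := by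
    intro q hq d hd f hf
    simp only [hT, mem_filter, mem_univ, true_and] at hq
    obtain ⟨k1, k2, k3⟩ := hC q.1 q.2 hq
    rw [mem_singleton.1 hf, card_eq_three]
    exact ⟨q.1, q.2, d, hq, fun e => k1 (e ▸ hd), fun e => k2 (e ▸ hd), rfl⟩
  have hsub : {ω : FaceIdx n 2 → Bool | ¬ ∀ a c, a ≠ c → ∃ d ∈ C a c,
      ∃ h : ({a, c, d} : Finset (Fin n)).card = 2 + 1, ω ⟨_, h⟩ = true} ⊆
      ⋃ q ∈ T, {ω | ∀ d ∈ C q.1 q.2, ω ∉ onS (Φ q d)} := by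
    intro ω hω
    simp only [Set.mem_ofPred_eq, not_forall] at hω
    obtain ⟨a, c, hac, hω⟩ := hω
    have hq : (a, c) ∈ T := by simp [hT, hac]
    refine Set.mem_biUnion (x := (a, c)) hq ?_
    intro d hd hon
    exact hω ⟨d, hd, sub3_on (c3 _ hq d hd) hon _ (mem_singleton_self _)⟩
  have hb : ∀ q ∈ T, (PM (FaceIdx n 2) p).real {ω | ∀ d ∈ C q.1 q.2, ω ∉ onS (Φ q d)} ≤
      Real.exp (-(0.0025 * r)) := by
    intro q hq
    have hq' := hq
    simp only [hT, mem_filter, mem_univ, true_and] at hq'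
    obtain ⟨k1, k2, k3⟩ := hC q.1 q.2 hq'
    refine (janson_exp hp0 hp1 (C q.1 q.2) (Φ q) ?_).trans (Real.exp_le_exp.2 ?_)
    · intro d hd
      rw [filter_false_of_mem]
      · simp
      · rintro d' hd' ⟨hne, hnd⟩
        refine hnd (Finset.disjoint_left.2 fun f hf hf' => hne ?_)
        simp only [hΦ, sub3, mem_subtype, mem_singleton] at hf hf'
        have : d' ∈ ({q.1, q.2, d} : Finset (Fin n)) := by rw [← hf, hf']; simp
        simp only [mem_insert, mem_singleton] at this
        rcases this with e | e | e
        · exact absurd (e ▸ hd') k1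
        · exact absurd (e ▸ hd') k2
        · exact e
    · have e : ∑ d ∈ C q.1 q.2, p ^ (Φ q d).card = (C q.1 q.2).card * p := by
        rw [← nsmul_eq_mul, ← sum_const]
        refine sum_congr rfl fun d hd => ?_
        rw [hΦ]; simp only
        rw [sub3_card (c3 q hq d hd)]; simp
      rw [e]
      have e2 : (n : ℝ) ≤ 2 * (C q.1 q.2).card := by
        exact_mod_cast (by omega : n ≤ 2 * (C q.1 q.2).card)
      have e3 : (n / 2 : ℝ) * (0.01 / r) ≤ (C q.1 q.2).card * p := by gcongr; linarith
      have e4 : (n / 2 : ℝ) * (0.01 / r) = 0.005 * r := by rw [← hr2]; field_simp; norm_num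
      linarith
  have hcard : (T.card : ℝ) ≤ n ^ 2 := by
    have h1 : T.card ≤ n * n := by
      refine (card_le_univ T).trans (le_of_eq ?_)
      simp
    rw [pow_two]
    exact_mod_cast h1
  calc _ ≤ ∑ q ∈ T, (PM (FaceIdx n 2) p).real {ω | ∀ d ∈ C q.1 q.2, ω ∉ onS (Φ q d)} :=
        (measureReal_mono hsub (measure_ne_top _ _)).trans (measureReal_biUnion_finset_le _ _)
    _ ≤ T.card • Real.exp (-(0.0025 * r)) := sum_le_card_nsmul _ _ _ hb
    _ ≤ _ := by rw [nsmul_eq_mul]; gcongr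

def SC (n : ℕ) : Set (FaceIdx n 2 → Bool) := {ω | SimplyConnectedSpace ↥(geomReal n (Ycomplex n 2 ω))}

theorem final_bound {n : ℕ} (hn : 20 ≤ n) {p r : ℝ} (hr : 1 ≤ r) (hr2 : r ^ 2 = n) (hp : 1 / (2 * r) ≤ p) (h : ℕ)
    (hh : h = 10000) (c1 : 10 * (4 + 4 ^ h) ≤ n) {M : ℝ} (hM : M = (4 + 4 ^ h : ℕ) + 1)
    (c2 : 0.49 / r * (M ^ 2 * Rb M h) ≤ 1 / 2) :
    YMeasure n 2 p (SC n)ᶜ ≤ ENNReal.ofReal (n ^ 2 * Real.exp (-n) + n ^ 2 * Real.exp (-(0.0025 * r))) := by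
  classical
  have hr0 : 0 < r := by linarith
  set p1 := 0.49 / r with hp1
  have a1 : 0 ≤ p1 := by positivity
  have a2 : p1 ≤ 0.49 := by rw [hp1]; exact div_le_self (by norm_num) hr
  have hq : 0.5 / r ≤ min p 1 := by
    refine le_min (le_trans (le_of_eq ?_) hp) ?_
    · field_simp; norm_num
    · exact (div_le_self (by norm_num) hr).trans (by norm_num)
  set q := min p 1 with hqd
  have hq1 : q ≤ 1 := min_le_right _ _
  have hq0 : 0 ≤ q := le_trans (by positivity) hq
  have hd : 0.01 / r ≤ q - p1 := by
    have : 0.5 / r - 0.49 / r = 0.01 / r := by ring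
    linarith
  have hd0 : 0 ≤ q - p1 := le_trans (by positivity) hd
  set p2 := (q - p1) / (1 - p1) with hp2
  have b0 : 0.01 / r ≤ p2 := hd.trans (le_div_self hd0 (by linarith) (by linarith))
  have b1 : p2 ≤ 1 := (div_le_one (by linarith)).2 (by linarith)
  have b2 : 0 ≤ p2 := le_trans (by positivity) b0
  have hcp : max 0 (min p 1) = 1 - (1 - p1) * (1 - p2) := by
    rw [← hqd, max_eq_right hq0, hp2]
    have : 1 - p1 ≠ 0 := by linarith
    field_simp
    ring
  have hY : YMeasure n 2 p = ((PM (FaceIdx n 2) p1).prod (PM (FaceIdx n 2) p2)).map (fun x => orF x.1 x.2) :=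
    PM_or a1 (by linarith) b2 b1 hcp
  have hm : Measurable (fun x : (FaceIdx n 2 → Bool) × (FaceIdx n 2 → Bool) => orF x.1 x.2) :=
    measurable_of_finite _
  rw [hY, Measure.map_apply hm (meas_all _), Measure.prod_apply (Set.toFinite _).measurableSet]
  have hsec : ∀ ω1 : FaceIdx n 2 → Bool, PM (FaceIdx n 2) p2 (Prod.mk ω1 ⁻¹' ((fun x : (FaceIdx n 2 → Bool) × (FaceIdx n 2 → Bool) => orF x.1 x.2) ⁻¹' (SC n)ᶜ))
      ≤ ({ω | ¬ Qp n ω} : Set (FaceIdx n 2 → Bool)).indicator 1 ω1 +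
        ENNReal.ofReal (n ^ 2 * Real.exp (-(0.0025 * r))) := by
    intro ω1
    by_cases hQ : Qp n ω1
    · refine le_trans ?_ le_add_self
      have hcl : ∀ a c : Fin n, ∃ C : Finset (Fin n), a ≠ c → a ∉ C ∧ c ∉ C ∧ 4 * n ≤ 5 * (C.card + 2) ∧
          ∀ u ∈ C, ∀ w ∈ C, Relation.EqvGen (Rel ω1 a c) u w := by
        intro a c
        by_cases hac : a = c
        · exact ⟨∅, fun k => absurd hac k⟩
        · obtain ⟨C, hC⟩ := Q_class hn hQ a c hac
          exact ⟨C, fun _ => hC⟩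
      choose C hC using hcl
      have hG := G_prob hn hr0 hr2 b1 b0 C (fun a c hac => ⟨(hC a c hac).1, (hC a c hac).2.1, (hC a c hac).2.2.1⟩)
      rw [← ofReal_measureReal]
      refine ENNReal.ofReal_le_ofReal (le_trans (measureReal_mono ?_) hG)
      intro ω2 h2 hall
      exact h2 (det hn C (fun a c hac => (hC a c hac).2.2.1) (fun a c hac => (hC a c hac).2.2.2) hall)
    · refine le_trans ?_ le_self_add
      have : ω1 ∈ ({ω | ¬ Qp n ω} : Set (FaceIdx n 2 → Bool)) := hQ
      rw [Set.indicator_of_mem this]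
      exact prob_le_one
  refine (lintegral_mono hsec).trans ?_
  rw [lintegral_add_right _ measurable_const, lintegral_indicator_one (meas_all _), lintegral_const, measure_univ,
    mul_one, ENNReal.ofReal_add (by positivity) (by positivity)]
  gcongr
  rw [← ofReal_measureReal]
  exact ENNReal.ofReal_le_ofReal (Q_prob hr0 hr2 hp1 (by linarith) h hh c1 hM c2)

end SCT
end

noncomputable section
/-- **Simple connectivity of `Y(n,p)`** (Korándi–Peled–Sudakov). If
`p ≥ 1/(2√n)` then w.h.p. the geometric realization of the random 2-complex
`Y(n,p)` is simply connected. -/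
theorem simply_connected_threshold (p : ℕ → ℝ)
    (hp : ∀ n : ℕ, 1 / (2 * Real.sqrt n) ≤ p n) :
    Tendsto (fun n : ℕ => YMeasure n 2 (p n)
        {ω | SimplyConnectedSpace ↥(geomReal n (Ycomplex n 2 ω))})
      atTop (nhds (1 : ENNReal)) := by
  obtain ⟨h, hh⟩ : ∃ h : ℕ, h = 10000 := ⟨_, rfl⟩
  obtain ⟨M, hM⟩ : ∃ M : ℝ, M = (4 + 4 ^ h : ℕ) + 1 := ⟨_, rfl⟩
  have hsq : Tendsto (fun n : ℕ => Real.sqrt n) atTop atTop :=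
    Real.tendsto_sqrt_atTop.comp tendsto_natCast_atTop_atTop
  have t1 : Tendsto (fun n : ℕ => (n : ℝ) ^ 2 * Real.exp (-n)) atTop (nhds 0) :=
    (Real.tendsto_pow_mul_exp_neg_atTop_nhds_zero 2).comp tendsto_natCast_atTop_atTop
  have t2 : Tendsto (fun n : ℕ => (n : ℝ) ^ 2 * Real.exp (-(0.0025 * Real.sqrt n))) atTop (nhds 0) := by
    have hx : Tendsto (fun n : ℕ => 0.0025 * Real.sqrt n) atTop atTop :=
      hsq.const_mul_atTop (by norm_num)
    have := ((Real.tendsto_pow_mul_exp_neg_atTop_nhds_zero 4).comp hx).const_mul ((400 : ℝ) ^ 4)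
    rw [mul_zero] at this
    refine this.congr fun n => ?_
    have e : (n : ℝ) ^ 2 = Real.sqrt n ^ 4 := by
      rw [show (4 : ℕ) = 2 * 2 from rfl, pow_mul, Real.sq_sqrt (by positivity)]
    rw [e]
    simp only [Function.comp]
    ring
  have t3 : Tendsto (fun n : ℕ => 0.49 / Real.sqrt n * (M ^ 2 * SCT.LT.Rb M h)) atTop (nhds 0) := by
    have := (hsq.const_div_atTop (0.49 : ℝ)).mul_const (M ^ 2 * SCT.LT.Rb M h)
    rwa [zero_mul] at this
  have t4 : Tendsto (fun n : ℕ => ENNReal.ofReal ((n : ℝ) ^ 2 * Real.exp (-n) +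
      (n : ℝ) ^ 2 * Real.exp (-(0.0025 * Real.sqrt n)))) atTop (nhds 0) := by
    have := ENNReal.tendsto_ofReal (t1.add t2)
    simpa using this
  have t5 : Tendsto (fun n : ℕ => YMeasure n 2 (p n) (SCT.SC n)ᶜ) atTop (nhds 0) := by
    refine tendsto_of_tendsto_of_tendsto_of_le_of_le' tendsto_const_nhds t4
      (Eventually.of_forall fun _ => zero_le) ?_
    filter_upwards [eventually_ge_atTop 20, eventually_ge_atTop (10 * (4 + 4 ^ h)),
      t3.eventually_le_const (show (0 : ℝ) < 1 / 2 by norm_num)] with n n1 n2 n3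
    refine SCT.final_bound n1 ?_ (Real.sq_sqrt (by positivity)) (hp n) h hh n2 hM n3
    rw [Real.one_le_sqrt]
    exact_mod_cast (by omega : 1 ≤ n)
  have t6 : Tendsto (fun n : ℕ => 1 - YMeasure n 2 (p n) (SCT.SC n)ᶜ) atTop (nhds (1 - 0)) :=
    ENNReal.Tendsto.sub tendsto_const_nhds t5 (Or.inl ENNReal.one_ne_top)
  rw [tsub_zero] at t6
  refine t6.congr fun n => ?_
  have : IsProbabilityMeasure (YMeasure n 2 (p n)) := by unfold YMeasure; infer_instance
  rw [prob_compl_eq_one_sub (SCT.meas_all _), ENNReal.sub_sub_cancel ENNReal.one_ne_top prob_le_one]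
  rfl
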